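/- arXiv:1205.4473 — 8 statements merged into one kernel-verified Lean document; each statement's English description precedes it below -/
import Mathlib

section
/- Let C be an additive category in which every split monomorphism has a cokernel, and let I be a class of objects of C closed under finite biproducts and direct summands. Then for objects X, Y of C the following are equivalent: (i) there exist morphisms f : X → Y and g : Y → X such that id_X − g∘f factors through an object of I and id_Y − f∘g factors through an object of I (i.e. X and Y are isomorphic in the quotient of C by maps factoring through I); (ii) there exist objects I ∈ I and J ∈ I such that X ⊕ J ≅ Y ⊕ I in C. -/
open CategoryTheory CategoryTheory.Limits

universe v u

variable {C : Type u} [Category.{v} C] [Preadditive C] [HasZeroObject C]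
  [HasBinaryBiproducts C]

/-- A morphism factors through some object of the class `I`. -/
def FactorsThroughClass (I : Set C) {A B : C} (h : A ⟶ B) : Prop :=
  ∃ (J : C) (u : A ⟶ J) (v : J ⟶ B), J ∈ I ∧ u ≫ v = h

/-- `Y` is a direct summand of `X`. -/
def IsDirectSummand (Y X : C) : Prop :=
  ∃ (i : Y ⟶ X) (r : X ⟶ Y), i ≫ r = 𝟙 Y

theorem FactorsThroughClass.add_aux {I : Set C} (hbiprod : ∀ X ∈ I, ∀ Y ∈ I, (X ⊞ Y) ∈ I)
    {A B : C} {h k : A ⟶ B} (hh : FactorsThroughClass I h) (hk : FactorsThroughClass I k) :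
    FactorsThroughClass I (h + k) := by
  obtain ⟨J, a, b, hJ, rfl⟩ := hh
  obtain ⟨L, c, d, hL, rfl⟩ := hk
  exact ⟨J ⊞ L, biprod.lift a c, biprod.desc b d, hbiprod _ hJ _ hL, by simp⟩

theorem FactorsThroughClass.comp_aux {I : Set C} {A B A' B' : C} {h : A ⟶ B}
    (hh : FactorsThroughClass I h) (a : A' ⟶ A) (b : B ⟶ B') :
    FactorsThroughClass I (a ≫ h ≫ b) := by
  obtain ⟨J, c, d, hJ, rfl⟩ := hh
  exact ⟨J, a ≫ c, d ≫ b, hJ, by simp⟩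

/-- Let `C` be an additive category in which every split monomorphism has a
cokernel, and `I` a class of objects closed under finite biproducts and direct summands.
Then `X ≅ Y` in the quotient of `C` by maps factoring through `I` (i.e. there are
`f : X ⟶ Y`, `g : Y ⟶ X` with `𝟙 X - f ≫ g` and `𝟙 Y - g ≫ f` factoring through `I`)
iff `X ⊞ J ≅ Y ⊞ I'` for some `I', J ∈ I`. -/
theorem stmt5
    (hcoker : ∀ ⦃X Y : C⦄ (f : X ⟶ Y), (∃ r : Y ⟶ X, f ≫ r = 𝟙 X) → HasCokernel f)
    (I : Set C)
    (hzero : ∀ Z : C, IsZero Z → Z ∈ I)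
    (hbiprod : ∀ X ∈ I, ∀ Y ∈ I, (X ⊞ Y) ∈ I)
    (hsummand : ∀ X ∈ I, ∀ Y : C, IsDirectSummand Y X → Y ∈ I)
    (X Y : C) :
    (∃ (f : X ⟶ Y) (g : Y ⟶ X),
        FactorsThroughClass I (𝟙 X - f ≫ g) ∧ FactorsThroughClass I (𝟙 Y - g ≫ f)) ↔
    (∃ I' ∈ I, ∃ J ∈ I, Nonempty ((X ⊞ J) ≅ (Y ⊞ I'))) := by
  constructor
  · rintro ⟨f, g, ⟨J, u, v, hJ, huv⟩, hY⟩
    obtain ⟨s, hs⟩ : ∃ s : X ⟶ Y ⊞ J, s = biprod.lift f u := ⟨_, rfl⟩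
    obtain ⟨r, hr⟩ : ∃ r : Y ⊞ J ⟶ X, r = biprod.desc g v := ⟨_, rfl⟩
    have hsr : s ≫ r = 𝟙 X := by
      rw [hs, hr, biprod.lift_desc, huv]; abel
    haveI := hcoker s ⟨r, hsr⟩
    have hsr' : ∀ {Z : C} (t : X ⟶ Z), s ≫ r ≫ t = t := fun t => by
      rw [← Category.assoc, hsr, Category.id_comp]
    obtain ⟨p, hp⟩ : ∃ p : Y ⊞ J ⟶ cokernel s, p = cokernel.π s := ⟨_, rfl⟩
    haveI : Epi p := by rw [hp]; infer_instance
    have hsp : s ≫ p = 0 := by rw [hp, cokernel.condition]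
    have he : s ≫ (𝟙 _ - r ≫ s) = 0 := by
      rw [Preadditive.comp_sub, hsr', Category.comp_id, sub_self]
    obtain ⟨j, hj⟩ : ∃ j : cokernel s ⟶ Y ⊞ J, p ≫ j = 𝟙 _ - r ≫ s :=
      ⟨cokernel.desc s _ he, by rw [hp, cokernel.π_desc]⟩
    have hjp : j ≫ p = 𝟙 _ := by
      rw [← cancel_epi p, ← Category.assoc, hj]
      simp [Preadditive.sub_comp, hsp]
    have hjr : j ≫ r = 0 := by
      rw [← cancel_epi p, ← Category.assoc, hj]
      simp [Preadditive.sub_comp, hsr]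
    have hE : FactorsThroughClass I (𝟙 _ - r ≫ s) := by
      have h1 := hY.comp_aux (biprod.fst : Y ⊞ J ⟶ Y) (biprod.inl : Y ⟶ Y ⊞ J)
      have h2 : FactorsThroughClass I
          ((biprod.snd : Y ⊞ J ⟶ J) ≫ ((biprod.inr : J ⟶ Y ⊞ J) - v ≫ s)) :=
        ⟨J, _, _, hJ, rfl⟩
      have h3 : FactorsThroughClass I
          ((-((biprod.fst : Y ⊞ J ⟶ Y) ≫ g ≫ u)) ≫ (biprod.inr : J ⟶ Y ⊞ J)) :=
        ⟨J, _, _, hJ, rfl⟩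
      convert (h1.add_aux hbiprod h2).add_aux hbiprod h3 using 1
      rw [hs, hr, ← biprod.total, biprod.desc_eq, biprod.lift_eq]
      simp only [Preadditive.sub_comp, Preadditive.comp_sub, Preadditive.add_comp,
        Preadditive.comp_add, Preadditive.neg_comp, Category.assoc, Category.id_comp]
      abel
    obtain ⟨L, a, b, hL, hab⟩ := hE
    refine ⟨J, hJ, cokernel s, hsummand L hL _ ⟨j ≫ a, b ≫ p, ?_⟩, ⟨?_⟩⟩
    · have : (j ≫ a) ≫ b ≫ p = j ≫ (a ≫ b) ≫ p := by simp
      rw [this, hab, ← hj, Category.assoc, hjp, Category.comp_id, hjp]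
    · refine ⟨biprod.desc s j, biprod.lift r p, ?_, ?_⟩
      · ext <;> simp [hsr, hsp, hjr, hjp]
      · rw [biprod.lift_desc, hj]; abel
  · rintro ⟨I', hI', J, hJ, ⟨φ⟩⟩
    refine ⟨biprod.inl ≫ φ.hom ≫ biprod.fst, biprod.inl ≫ φ.inv ≫ biprod.fst,
      ⟨I', biprod.inl ≫ φ.hom ≫ biprod.snd, biprod.inr ≫ φ.inv ≫ biprod.fst, hI', ?_⟩,
      ⟨J, biprod.inl ≫ φ.inv ≫ biprod.snd, biprod.inr ≫ φ.hom ≫ biprod.fst, hJ, ?_⟩⟩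
    · rw [eq_sub_iff_add_eq]
      have : biprod.inl ≫ φ.hom ≫ (biprod.fst ≫ biprod.inl + biprod.snd ≫ biprod.inr) ≫
          φ.inv ≫ biprod.fst = 𝟙 X := by rw [biprod.total]; simp
      rw [← this]
      simp only [Preadditive.add_comp, Preadditive.comp_add, Category.assoc]
      abel
    · rw [eq_sub_iff_add_eq]
      have : biprod.inl ≫ φ.inv ≫ (biprod.fst ≫ biprod.inl + biprod.snd ≫ biprod.inr) ≫
          φ.hom ≫ biprod.fst = 𝟙 Y := by rw [biprod.total]; simp
      rw [← this]
      simp only [Preadditive.add_comp, Preadditive.comp_add, Category.assoc]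
      abel
end

section
/- Let A be an abelian category with enough injectives, and let (W1, F1) and (W2, F2) be complete cotorsion pairs in A such that W1 and W2 are thick, W1 ∩ F1 and W2 ∩ F2 both equal the class of injective objects of A, and F2 ⊆ F1. Then for every object X of A the following are equivalent: (i) there exists a short exact sequence 0 → X → A → B → 0 with A ∈ F2 and B ∈ W1; (ii) there exists a short exact sequence 0 → A → B → X → 0 with A ∈ F2 and B ∈ W1. -/
open CategoryTheory CategoryTheory.Limits CategoryTheory.Abelian

universe w v u

variable {C : Type u} [Category.{v} C] [Abelian C]

/-- `f : X ⟶ Y` and `g : Y ⟶ Z` form a short exact sequence `0 → X → Y → Z → 0`. -/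
def IsShortExactSeq {X Y Z : C} (f : X ⟶ Y) (g : Y ⟶ Z) : Prop :=
  ∃ zero : f ≫ g = 0, (ShortComplex.mk f g zero).ShortExact

/-- `(D, E)` is a cotorsion pair: each class is the `Ext¹`-orthogonal of the other. -/
def IsCotorsionPair [HasExt.{w} C] (D E : Set C) : Prop :=
  (∀ X : C, X ∈ D ↔ ∀ Y ∈ E, Subsingleton (Ext.{w} X Y 1)) ∧
  (∀ Y : C, Y ∈ E ↔ ∀ X ∈ D, Subsingleton (Ext.{w} X Y 1))

/-- `(D, E)` is a complete cotorsion pair. -/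
def IsCompleteCotorsionPair [HasExt.{w} C] (D E : Set C) : Prop :=
  IsCotorsionPair.{w} D E ∧
  (∀ Z : C, ∃ (X Y : C) (f : Y ⟶ X) (g : X ⟶ Z), IsShortExactSeq f g ∧ X ∈ D ∧ Y ∈ E) ∧
  (∀ Z : C, ∃ (Y X : C) (f : Z ⟶ Y) (g : Y ⟶ X), IsShortExactSeq f g ∧ Y ∈ E ∧ X ∈ D)

/-- A class of objects is thick: closed under direct summands and satisfying the
2-out-of-3 property for short exact sequences. -/
def IsThickClass (W : Set C) : Prop :=
  (∀ X Y : C, X ∈ W → (∃ (i : Y ⟶ X) (r : X ⟶ Y), i ≫ r = 𝟙 Y) → Y ∈ W) ∧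
  (∀ ⦃X Y Z : C⦄ (f : X ⟶ Y) (g : Y ⟶ Z), IsShortExactSeq f g →
    ((X ∈ W ∧ Y ∈ W) ∨ (X ∈ W ∧ Z ∈ W) ∨ (Y ∈ W ∧ Z ∈ W)) → (X ∈ W ∧ Y ∈ W ∧ Z ∈ W))

theorem ses_of_kernel {X Y Z : C} (f : X ⟶ Y) (g : Y ⟶ Z) [Mono f] [Epi g] (w : f ≫ g = 0)
    (h : ∀ {T : C} (t : T ⟶ Y), t ≫ g = 0 → ∃ l : T ⟶ X, l ≫ f = t) :
    IsShortExactSeq f g := by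
  refine ⟨w, ?_⟩
  have hl : IsLimit (KernelFork.ofι f w) :=
    KernelFork.IsLimit.ofι f w (fun t ht => (h t ht).choose) (fun t ht => (h t ht).choose_spec)
      (fun t ht m hm => by
        rw [← cancel_mono f, hm]; exact (h t ht).choose_spec.symm)
  exact ShortComplex.ShortExact.mk' (ShortComplex.exact_of_f_is_kernel _ hl) ‹_› ‹_›

theorem ses_of_cokernel {X Y Z : C} (f : X ⟶ Y) (g : Y ⟶ Z) [Mono f] [Epi g] (w : f ≫ g = 0)
    (h : ∀ {T : C} (t : Y ⟶ T), f ≫ t = 0 → ∃ l : Z ⟶ T, g ≫ l = t) :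
    IsShortExactSeq f g := by
  refine ⟨w, ?_⟩
  have hl : IsColimit (CokernelCofork.ofπ g w) :=
    CokernelCofork.IsColimit.ofπ g w (fun t ht => (h t ht).choose)
      (fun t ht => (h t ht).choose_spec)
      (fun t ht m hm => by
        rw [← cancel_epi g, hm]; exact (h t ht).choose_spec.symm)
  exact ShortComplex.ShortExact.mk' (ShortComplex.exact_of_g_is_cokernel _ hl) ‹_› ‹_›

theorem ses_lift {X Y Z : C} {f : X ⟶ Y} {g : Y ⟶ Z} (h : IsShortExactSeq f g)
    {T : C} (t : T ⟶ Y) (ht : t ≫ g = 0) : ∃ l : T ⟶ X, l ≫ f = t := by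
  obtain ⟨w, h⟩ := h
  have := h.mono_f
  exact ⟨h.exact.lift t ht, h.exact.lift_f t ht⟩

theorem ses_desc {X Y Z : C} {f : X ⟶ Y} {g : Y ⟶ Z} (h : IsShortExactSeq f g)
    {T : C} (t : Y ⟶ T) (ht : f ≫ t = 0) : ∃ l : Z ⟶ T, g ≫ l = t := by
  obtain ⟨w, h⟩ := h
  have := h.epi_g
  exact ⟨h.exact.desc t ht, h.exact.g_desc t ht⟩

theorem ses_mono {X Y Z : C} {f : X ⟶ Y} {g : Y ⟶ Z} (h : IsShortExactSeq f g) : Mono f :=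
  h.2.mono_f

theorem ses_epi {X Y Z : C} {f : X ⟶ Y} {g : Y ⟶ Z} (h : IsShortExactSeq f g) : Epi g :=
  h.2.epi_g

theorem ses_coker {X Y : C} (f : X ⟶ Y) [Mono f] : IsShortExactSeq f (cokernel.π f) :=
  ses_of_cokernel f _ (cokernel.condition f) (fun t ht => ⟨cokernel.desc f t ht, by simp⟩)

theorem ses_ker {X Y : C} (f : X ⟶ Y) [Epi f] : IsShortExactSeq (kernel.ι f) f :=
  ses_of_kernel _ f (kernel.condition f) (fun t ht => ⟨kernel.lift f t ht, by simp⟩)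

/-- The pullback diagram. -/
theorem ses_pullback {F I A X B : C} {f : F ⟶ I} {g : I ⟶ A} {i : X ⟶ A} {q : A ⟶ B}
    (h₁ : IsShortExactSeq f g) (h₂ : IsShortExactSeq i q) :
    ∃ (P : C) (a : F ⟶ P) (b : P ⟶ X) (c : P ⟶ I) (d : I ⟶ B),
      IsShortExactSeq a b ∧ IsShortExactSeq c d := by
  have := ses_mono h₁
  have := ses_mono h₂
  have := ses_epi h₁
  have := ses_epi h₂
  have w₁ := h₁.1
  have w₂ := h₂.1
  refine ⟨pullback i g, pullback.lift 0 f (by simp [w₁]), pullback.fst i g, pullback.snd i g,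
    g ≫ q, ?_, ?_⟩
  · have : Mono (pullback.lift 0 f (by simp [w₁]) : F ⟶ pullback i g) :=
      mono_of_mono_fac (pullback.lift_snd _ _ _)
    refine ses_of_kernel _ _ (pullback.lift_fst _ _ _) ?_
    intro T t ht
    obtain ⟨l, hl⟩ := ses_lift h₁ (t ≫ pullback.snd i g) (by
      rw [Category.assoc, ← pullback.condition, reassoc_of% ht, zero_comp])
    refine ⟨l, ?_⟩
    apply pullback.hom_ext
    · rw [Category.assoc, pullback.lift_fst, ht, comp_zero]
    · rw [Category.assoc, pullback.lift_snd, hl]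
  · have : Epi (g ≫ q) := epi_comp _ _
    refine ses_of_kernel _ _ (by rw [← pullback.condition_assoc, w₂, comp_zero]) ?_
    intro T t ht
    obtain ⟨l, hl⟩ := ses_lift h₂ (t ≫ g) (by simpa using ht)
    exact ⟨pullback.lift l t hl, pullback.lift_snd _ _ _⟩

/-- The pushout diagram. -/
theorem ses_pushout {A B X I B' : C} {f : A ⟶ B} {g : B ⟶ X} {i : B ⟶ I} {q : I ⟶ B'}
    (h₁ : IsShortExactSeq f g) (h₂ : IsShortExactSeq i q) :
    ∃ (P : C) (a : A ⟶ I) (b : I ⟶ P) (c : X ⟶ P) (d : P ⟶ B'),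
      IsShortExactSeq a b ∧ IsShortExactSeq c d := by
  have := ses_mono h₁
  have := ses_mono h₂
  have := ses_epi h₁
  have := ses_epi h₂
  have w₁ := h₁.1
  have w₂ := h₂.1
  refine ⟨pushout g i, f ≫ i, pushout.inr g i, pushout.inl g i,
    pushout.desc 0 q (by simp [w₂]), ?_, ?_⟩
  · have : Mono (f ≫ i) := mono_comp _ _
    refine ses_of_cokernel _ _ (by
      rw [Category.assoc, ← pushout.condition, reassoc_of% w₁, zero_comp]) ?_
    intro T t ht
    obtain ⟨l, hl⟩ := ses_desc h₁ (i ≫ t) (by simpa using ht)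
    exact ⟨pushout.desc l t hl, pushout.inr_desc _ _ _⟩
  · have : Epi (pushout.desc 0 q (by simp [w₂]) : pushout g i ⟶ B') :=
      epi_of_epi_fac (pushout.inr_desc _ _ _)
    refine ses_of_cokernel _ _ (pushout.inl_desc _ _ _) ?_
    intro T t ht
    obtain ⟨l, hl⟩ := ses_desc h₂ (pushout.inr g i ≫ t) (by
      rw [← pushout.condition_assoc, ht, comp_zero])
    refine ⟨l, ?_⟩
    apply pushout.hom_ext
    · rw [pushout.inl_desc_assoc, ht, zero_comp]
    · rw [pushout.inr_desc_assoc, hl]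

theorem cot_ext_closed [HasExt.{w} C] {D E : Set C} (h : IsCotorsionPair.{w} D E)
    {X Y Z : C} {f : X ⟶ Y} {g : Y ⟶ Z} (hs : IsShortExactSeq f g) (hX : X ∈ E) (hZ : Z ∈ E) :
    Y ∈ E := by
  obtain ⟨w, hs⟩ := hs
  rw [h.2]
  intro W hW
  have h1 := (h.2 X).1 hX W hW
  have h3 := (h.2 Z).1 hZ W hW
  refine subsingleton_of_forall_eq 0 (fun x => ?_)
  obtain ⟨y, rfl⟩ := Ext.covariant_sequence_exact₂ W hs x (h3.elim _ _)
  rw [h1.elim y 0, Ext.zero_comp]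

theorem ext_effaceable [EnoughInjectives C] [HasExt.{w} C] {W A : C} (x : Ext.{w} W A 1) :
    ∃ (E : C) (p : E ⟶ W), Epi p ∧ (Ext.mk₀ p).comp x (zero_add 1) = 0 := by
  obtain ⟨w, hs⟩ := ses_coker (Injective.ι A)
  obtain ⟨y, rfl⟩ := Ext.covariant_sequence_exact₁ W hs x (Ext.eq_zero_of_injective _) (zero_add 1)
  obtain ⟨φ, rfl⟩ := (Ext.mk₀_bijective _ _).2 y
  refine ⟨pullback φ (cokernel.π (Injective.ι A)), pullback.fst _ _, inferInstance, ?_⟩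
  dsimp only
  rw [Ext.mk₀_comp_mk₀_assoc, pullback.condition, ← Ext.mk₀_comp_mk₀_assoc]
  erw [hs.comp_extClass]
  rw [Ext.comp_zero]

theorem cot_coker_closed [EnoughInjectives C] [HasExt.{w} C] {D E : Set C}
    (h : IsCompleteCotorsionPair.{w} D E) (ht : IsThickClass D)
    {A I A' : C} [Injective I] {f : A ⟶ I} {g : I ⟶ A'} (hs : IsShortExactSeq f g) (hA : A ∈ E) :
    A' ∈ E := by
  obtain ⟨w, hs⟩ := hs
  rw [h.1.2]
  intro W hW
  refine subsingleton_of_forall_eq 0 (fun x => ?_)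
  obtain ⟨E', p, hp, hpx⟩ := ext_effaceable x
  obtain ⟨W'', F, a, b, hab, hW'', hF⟩ := h.2.1 E'
  have := ses_epi hab
  have hk := ses_ker (b ≫ p)
  have hK : kernel (b ≫ p) ∈ D := (ht.2 _ _ hk (Or.inr (Or.inr ⟨hW'', hW⟩))).1
  obtain ⟨w', hk⟩ := hk
  obtain ⟨y, rfl⟩ := Ext.contravariant_sequence_exact₃ hk A' x (by
    dsimp only
    rw [← Ext.mk₀_comp_mk₀_assoc, hpx, Ext.comp_zero]) (add_zero 1)
  have := (h.1.2 A).1 hA _ hK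
  obtain ⟨z, rfl⟩ := Ext.covariant_sequence_exact₃ _ hs y (zero_add 1) (this.elim _ _)
  rw [← Ext.comp_assoc_of_third_deg_zero, Ext.eq_zero_of_injective (hk.extClass.comp z _),
    Ext.zero_comp]

/-- Given complete cotorsion pairs `(W₁, F₁)`, `(W₂, F₂)` with `W₁`, `W₂`
thick, `Wᵢ ∩ Fᵢ` the class of injectives, and `F₂ ⊆ F₁`: for every object `X` there exists
a short exact sequence `0 → X → A → B → 0` with `A ∈ F₂`, `B ∈ W₁` iff there exists a
short exact sequence `0 → A → B → X → 0` with `A ∈ F₂`, `B ∈ W₁`. -/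
theorem stmt7 [EnoughInjectives C] [HasExt.{w} C] (W₁ F₁ W₂ F₂ : Set C)
    (hpair₁ : IsCompleteCotorsionPair.{w} W₁ F₁)
    (hpair₂ : IsCompleteCotorsionPair.{w} W₂ F₂)
    (hthick₁ : IsThickClass W₁) (hthick₂ : IsThickClass W₂)
    (hWF₁ : W₁ ∩ F₁ = {X : C | Injective X})
    (hWF₂ : W₂ ∩ F₂ = {X : C | Injective X})
    (hsub : F₂ ⊆ F₁) (X : C) :
    (∃ (A B : C) (f : X ⟶ A) (g : A ⟶ B), IsShortExactSeq f g ∧ A ∈ F₂ ∧ B ∈ W₁) ↔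
    (∃ (A B : C) (f : A ⟶ B) (g : B ⟶ X), IsShortExactSeq f g ∧ A ∈ F₂ ∧ B ∈ W₁) := by
  have hinj₁ : ∀ {J : C}, Injective J → J ∈ W₁ := fun {J} hJ => by
    have : J ∈ W₁ ∩ F₁ := by rw [hWF₁]; exact hJ
    exact this.1
  constructor
  · rintro ⟨A, B, f, g, hs, hA, hB⟩
    obtain ⟨I, F, a, b, hab, hI, hF⟩ := hpair₂.2.1 A
    have hI' : I ∈ F₂ := cot_ext_closed hpair₂.1 hab hF hA
    have hII : I ∈ W₂ ∩ F₂ := ⟨hI, hI'⟩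
    rw [hWF₂] at hII
    obtain ⟨P, a', b', c, d, h1, h2⟩ := ses_pullback hab hs
    exact ⟨F, P, a', b', h1, hF, (hthick₁.2 _ _ h2 (Or.inr (Or.inr ⟨hinj₁ hII, hB⟩))).1⟩
  · rintro ⟨A, B, f, g, hs, hA, hB⟩
    have hι := ses_coker (Injective.ι B)
    have hB' := (hthick₁.2 _ _ hι (Or.inl ⟨hB, hinj₁ inferInstance⟩)).2.2
    obtain ⟨P, a, b, c, d, h1, h2⟩ := ses_pushout hs hι
    exact ⟨P, _, c, d, h2, cot_coker_closed hpair₂ hthick₂ h1 hA, hB'⟩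
end

section
/- Let R be a ring of finite left-global dimension, i.e. there exists n such that every left R-module has projective dimension at most n. Then in the abelian category Ch(R) of ℤ-indexed cochain complexes of left R-modules, the class {X | Ext^1_{Ch(R)}(X, Z) = 0 for every acyclic complex Z} equals the class of complexes all of whose components are projective R-modules. -/
open CategoryTheory CategoryTheory.Limits CategoryTheory.Abelian

universe w u

/-- An `R`-module `M` has projective dimension at most `n`: it admits a projective
resolution vanishing in degrees above `n`. -/
def HasProjDimLE {R : Type u} [Ring R] (M : ModuleCat.{u} R) (n : ℕ) : Prop :=
  ∃ P : ProjectiveResolution M, ∀ i : ℕ, n < i → IsZero (P.complex.X i)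

/-- A cochain complex is acyclic if it is exact in every degree. -/
def IsAcyclicComplex {R : Type u} [Ring R] (X : CochainComplex (ModuleCat.{u} R) ℤ) : Prop :=
  ∀ n : ℤ, X.ExactAt n

open CochainComplex CochainComplex.HomComplex

namespace Stmt10Aux

universe vv uu

variable {C : Type uu} [Category.{vv} C] [Abelian C]

/-- Every cocycle from `X` to `Z` is a coboundary. -/
def CobAll (X Z : CochainComplex C ℤ) : Prop :=
  ∀ (m n : ℤ) (_ : m + 1 = n) (c : Cochain X Z n), δ n (n + 1) c = 0 →
    ∃ b : Cochain X Z m, δ m n b = c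

lemma cobAll_of_contractible (X Z : CochainComplex C ℤ) (h : Homotopy (𝟙 Z) 0) :
    CobAll X Z := by
  intro m n hmn c hc
  obtain ⟨z, hz⟩ := Cochain.equivHomotopy _ _ h
  simp only [Cochain.ofHom_zero, add_zero] at hz
  refine ⟨c.comp z (by lia), ?_⟩
  rw [δ_comp c z (by lia) (n + 1) 0 n hmn rfl (by lia), ← hz, hc]
  simp

/-- Lifting cocycles along a short exact sequence. -/
lemma lift_cocycle (X : CochainComplex C ℤ) (hX : ∀ n, Projective (X.X n))
    (S : ShortComplex (CochainComplex C ℤ)) (hS : S.ShortExact) (h : CobAll X S.X₁)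
    (n : ℤ) (c : Cochain X S.X₃ n) (hc : δ n (n + 1) c = 0) :
    ∃ b : Cochain X S.X₂ n, δ n (n + 1) b = 0 ∧ b.comp (Cochain.ofHom S.g) (add_zero n) = c := by
  have hSn : ∀ i, (S.map (HomologicalComplex.eval C (ComplexShape.up ℤ) i)).ShortExact :=
    fun i => hS.map_of_exact _
  have hepi : ∀ i, Epi (S.g.f i) := fun i => (hSn i).epi_g
  have hmono : ∀ i, Mono (S.f.f i) := fun i => (hSn i).mono_f
  let b : Cochain X S.X₂ n := Cochain.mk fun p q hpq =>
    Projective.factorThru (c.v p q hpq) (S.g.f q)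
  have hb : b.comp (Cochain.ofHom S.g) (add_zero n) = c := by
    ext p q hpq
    simp [b]
  have hδb : (δ n (n + 1) b).comp (Cochain.ofHom S.g) (add_zero _) = 0 := by
    rw [← δ_comp_ofHom, hb, hc]
  have hk : ∀ p q hpq, (δ n (n + 1) b).v p q hpq ≫ S.g.f q = 0 := by
    intro p q hpq
    simpa using Cochain.congr_v hδb p q hpq
  have ha : ∃ a : Cochain X S.X₁ (n + 1),
      a.comp (Cochain.ofHom S.f) (add_zero _) = δ n (n + 1) b := by
    have : ∀ p q hpq, ∃ a : X.X p ⟶ S.X₁.X q, a ≫ S.f.f q = (δ n (n + 1) b).v p q hpq := by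
      intro p q hpq
      have := (hSn q).mono_f
      exact ⟨(hSn q).exact.lift _ (hk p q hpq), (hSn q).exact.lift_f _ _⟩
    choose a ha using this
    refine ⟨Cochain.mk a, ?_⟩
    ext p q hpq
    simp [ha]
  obtain ⟨a, ha⟩ := ha
  have hδa : δ (n + 1) (n + 1 + 1) a = 0 := by
    have h0 : (δ (n + 1) (n + 1 + 1) a).comp (Cochain.ofHom S.f) (add_zero _) = 0 := by
      rw [← δ_comp_ofHom, ha, δ_δ]
    ext p q hpq
    rw [← cancel_mono (S.f.f q)]
    simpa using Cochain.congr_v h0 p q hpq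
  obtain ⟨e, he⟩ := h n (n + 1) rfl a hδa
  refine ⟨b - e.comp (Cochain.ofHom S.f) (add_zero _), ?_, ?_⟩
  · rw [δ_sub, δ_comp_ofHom, he, ha, sub_self]
  · rw [Cochain.sub_comp, hb]
    ext p q hpq
    have : S.f.f q ≫ S.g.f q = 0 := by
      rw [← HomologicalComplex.comp_f, S.zero, HomologicalComplex.zero_f]
    simp [this]

/-- A graded object seen as a complex with zero differential. -/
def gr (F : ℤ → C) : CochainComplex C ℤ where
  X := F
  d _ _ := 0

lemma exactAt_of_contractible (Z : CochainComplex C ℤ) (h : Homotopy (𝟙 Z) 0) (n : ℤ) :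
    Z.ExactAt n := by
  rw [HomologicalComplex.exactAt_iff_isZero_homology, IsZero.iff_id_eq_zero]
  have := h.homologyMap_eq n
  simpa using this

lemma acyclic_X₁ (S : ShortComplex (CochainComplex C ℤ)) (hS : S.ShortExact)
    (h₂ : ∀ n, S.X₂.ExactAt n) (h₃ : ∀ n, S.X₃.ExactAt n) (n : ℤ) : S.X₁.ExactAt n := by
  have k₂ := fun n => (HomologicalComplex.exactAt_iff_isZero_homology _ _).1 (h₂ n)
  have k₃ := fun n => (HomologicalComplex.exactAt_iff_isZero_homology _ _).1 (h₃ n)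
  exact hS.exactAt_X₁ n ⟨fun _ _ _ => (k₂ n).eq_of_tgt _ _⟩
    (fun i _ => ⟨fun _ _ _ => (k₃ i).eq_of_src _ _⟩)

lemma shortExact_kernel {A B : CochainComplex C ℤ} (q : A ⟶ B) (h : ∀ n, Epi (q.f n)) :
    (ShortComplex.mk (kernel.ι q) q (kernel.condition q)).ShortExact := by
  have : Epi q := HomologicalComplex.epi_of_epi_f _ h
  exact { exact := ShortComplex.exact_kernel q
          mono_f := inferInstance
          epi_g := inferInstance }

lemma projective_of_ext [HasExt.{w} (CochainComplex C ℤ)] [EnoughProjectives C]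
    (X : CochainComplex C ℤ)
    (hX : ∀ Z : CochainComplex C ℤ, (∀ n, Z.ExactAt n) → Subsingleton (Ext.{w} X Z 1)) (n : ℤ) :
    Projective (X.X n) := by
  let K := gr (fun p => X.X p)
  let F := gr (fun p => Projective.over (X.X p))
  let e : F ⟶ K := { f := fun p => Projective.π (X.X p), comm' := by intros; simp [F, K, gr] }
  let q : mappingCone (𝟙 F) ⟶ mappingCone (𝟙 K) := mappingCone.map _ _ e e (by simp)
  have he : ∀ p, Epi (e.f p) := fun p => inferInstanceAs (Epi (Projective.π (X.X p)))
  have hq : ∀ p, Epi (q.f p) := by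
    intro p
    constructor
    intro Y a b hab
    refine mappingCone.ext_from (𝟙 K) (p + 1) p rfl ?_ ?_
    · rw [← cancel_epi (e.f (p + 1))]
      have := (mappingCone.inl (𝟙 F)).v (p + 1) p (by lia) ≫= hab
      simpa [q, mappingCone.map] using this
    · rw [← cancel_epi (e.f p)]
      have := (mappingCone.inr (𝟙 F)).f p ≫= hab
      simpa [q, mappingCone.map] using this
  have hS := shortExact_kernel q hq
  have hac : ∀ n, (kernel q).ExactAt n := acyclic_X₁ _ hS
    (exactAt_of_contractible _ (mappingCone.homotopyToZeroOfId _))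
    (exactAt_of_contractible _ (mappingCone.homotopyToZeroOfId _))
  let β : Cochain X K 0 := Cochain.ofHoms (fun p => 𝟙 (X.X p))
  let l : X ⟶ mappingCone (𝟙 K) := mappingCone.lift _
    (Cocycle.mk (-δ 0 1 β) 2 (by norm_num) (by rw [δ_neg, δ_δ, neg_zero])) β (by
      simp [Cocycle.mk])
  have := hX _ hac
  obtain ⟨x₂, hx₂⟩ := Ext.covariant_sequence_exact₃ X hS (Ext.mk₀ l) (zero_add 1)
    (Subsingleton.elim _ _)
  obtain ⟨t, rfl⟩ := (Ext.mk₀_bijective _ _).2 x₂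
  rw [Ext.mk₀_comp_mk₀] at hx₂
  have ht : t ≫ q = l := (Ext.mk₀_bijective _ _).1 hx₂
  have hs : (mappingCone.snd (𝟙 F)).v n n (add_zero n) ≫ e.f n =
      q.f n ≫ (mappingCone.snd (𝟙 K)).v n n (add_zero n) := by
    refine mappingCone.ext_from (𝟙 F) (n + 1) n rfl ?_ ?_ <;> simp [q, mappingCone.map]
  have h1 : (t.f n ≫ (mappingCone.snd (𝟙 F)).v n n (add_zero n)) ≫ e.f n = 𝟙 (X.X n) := by
    rw [Category.assoc, hs, ← Category.assoc, ← HomologicalComplex.comp_f, ht]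
    simp only [l, mappingCone.lift_f_snd_v]
    exact Cochain.ofHoms_v (F := X) (G := K) (fun p => 𝟙 (X.X p)) n
  exact Retract.projective (Y := Projective.over (X.X n)) ⟨_, _, h1⟩

/-- Every complex is a degreewise epimorphic image of a contractible one with projective terms. -/
lemma exists_cover [EnoughProjectives C] (Z : CochainComplex C ℤ) :
    ∃ (P : CochainComplex C ℤ) (q : P ⟶ Z), (∀ n, Epi (q.f n)) ∧ (∀ n, Projective (P.X n)) ∧
      Nonempty (Homotopy (𝟙 P) 0) := by
  let K := gr (fun p => Projective.over (Z.X (p - 1)))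
  let α : Cochain K Z (-1) := Cochain.mk fun p q hpq =>
    Projective.π (Z.X (p - 1)) ≫ (Z.XIsoOfEq (show p - 1 = q by lia)).hom
  let β : K ⟶ Z := Cocycle.homOf (Cocycle.mk (δ (-1) 0 α) 1 (by norm_num) (by rw [δ_δ]))
  let q : mappingCone (𝟙 K) ⟶ Z := mappingCone.desc _ α β (by
    rw [Category.id_comp]
    exact (Cocycle.cochain_ofHom_homOf_eq_coe
      (Cocycle.mk (δ (-1) 0 α) 1 (by norm_num) (by rw [δ_δ]))).symm)
  refine ⟨_, q, ?_, ?_, ⟨mappingCone.homotopyToZeroOfId _⟩⟩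
  · intro n
    have h1 : (mappingCone.inl (𝟙 K)).v (n + 1) n (by lia) ≫ q.f n =
      Projective.π (Z.X (n + 1 - 1)) ≫ (Z.XIsoOfEq (show n + 1 - 1 = n by lia)).hom := by
      simp only [q, mappingCone.inl_v_desc_f]
      rfl
    have : Epi ((mappingCone.inl (𝟙 K)).v (n + 1) n (by lia) ≫ q.f n) := by
      rw [h1]
      exact epi_comp (Projective.π (Z.X (n + 1 - 1))) (Z.XIsoOfEq _).hom
    exact epi_of_epi ((mappingCone.inl (𝟙 K)).v (n + 1) n _) _
  · intro n
    have hK : ∀ p, Projective (K.X p) :=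
      fun p => inferInstanceAs (Projective (Projective.over (Z.X (p - 1))))
    exact Projective.of_iso
      (HomologicalComplex.homotopyCofiber.XIsoBiprod (𝟙 K) n (n + 1) rfl).symm inferInstance

lemma shortExact_cycles (Z : CochainComplex C ℤ) (hZ : ∀ n, Z.ExactAt n) (n : ℤ) :
    (ShortComplex.mk (Z.iCycles n) (Z.toCycles n (n + 1)) (by
      rw [← cancel_mono (Z.iCycles (n + 1))]; simp)).ShortExact := by
  have hepi : Epi (Z.toCycles n (n + 1)) := by
    have := (HomologicalComplex.exactAt_iff_isZero_homology _ _).1 (hZ (n + 1))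
    exact Preadditive.epi_of_isZero_cokernel' _ (Z.homologyIsCokernel n (n + 1) (by simp)) this
  refine { exact := ?_, mono_f := inferInstanceAs (Mono (Z.iCycles n)), epi_g := hepi }
  apply ShortComplex.exact_of_f_is_kernel
  refine KernelFork.IsLimit.ofι' _ _ fun {A} k hk => 
    ⟨Z.liftCycles k (n + 1) (by simp) ?_, Z.liftCycles_i _ _ _ _⟩
  have hk' : k ≫ Z.toCycles n (n + 1) = 0 := hk
  rw [← Z.toCycles_i n (n + 1), reassoc_of% hk', zero_comp]

lemma contractible_of_projective (Z : CochainComplex C ℤ) (hZ : ∀ n, Z.ExactAt n)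
    (hP : ∀ n, Projective (Z.X n)) (N : ℕ)
    (hN : ∀ M : C, HasProjectiveDimensionLT M (N + 1)) : Nonempty (Homotopy (𝟙 Z) 0) := by
  have hcyc : ∀ (k : ℕ), k ≤ N → ∀ n, HasProjectiveDimensionLT (Z.cycles n) (N - k + 1) := by
    intro k
    induction k with
    | zero => intro _ n; exact hN _
    | succ k ih =>
      intro hk n
      have h3 := ih (by lia) (n + 1)
      rw [show N - k + 1 = N - (k + 1) + 2 by lia] at h3
      exact ((shortExact_cycles Z hZ n).hasProjectiveDimensionLT_X₃_iff _ (hP n)).1 h3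
  have hproj : ∀ n, Projective (Z.cycles n) := fun n => by
    have := hcyc N le_rfl n
    rw [Nat.sub_self, zero_add] at this
    exact projective_iff_hasProjectiveDimensionLT_one.2 this
  have hsec : ∀ p q (hpq : p + 1 = q), ∃ s : Z.cycles q ⟶ Z.X p, s ≫ Z.toCycles p q = 𝟙 _ := by
    rintro p _ rfl
    have : Epi (Z.toCycles p (p + 1)) := (shortExact_cycles Z hZ p).epi_g
    exact ⟨Projective.factorThru (𝟙 _) (Z.toCycles p (p + 1)), by simp⟩
  choose s hs using hsec
  have hr : ∀ p, ∃ r : Z.X p ⟶ Z.cycles p,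
      r ≫ Z.iCycles p = 𝟙 _ - Z.toCycles p (p + 1) ≫ s p (p + 1) rfl := by
    intro p
    refine ⟨Z.liftCycles (𝟙 _ - Z.toCycles p (p + 1) ≫ s p (p + 1) rfl) (p + 1) (by simp) ?_,
      Z.liftCycles_i _ _ _ _⟩
    rw [← Z.toCycles_i p (p + 1), Preadditive.sub_comp, Category.assoc,
      reassoc_of% (hs p (p + 1) rfl), Category.id_comp, sub_self]
  choose r hr using hr
  have hri : ∀ p, Z.iCycles p ≫ r p = 𝟙 _ := by
    intro p
    have h0 : Z.iCycles p ≫ Z.toCycles p (p + 1) = 0 := by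
      rw [← cancel_mono (Z.iCycles (p + 1))]; simp
    rw [← cancel_mono (Z.iCycles p), Category.assoc, hr]
    simp [reassoc_of% h0]
  refine ⟨(Cochain.equivHomotopy _ _).symm
    ⟨Cochain.mk fun p q hpq => r p ≫ s q p (by lia), ?_⟩⟩
  ext p
  have h1 : Z.toCycles p (p + 1) ≫ s p (p + 1) rfl = Z.d p (p + 1) ≫ r (p + 1) ≫ s p (p + 1) rfl := by
    rw [← Z.toCycles_i p (p + 1), Category.assoc, reassoc_of% (hri (p + 1))]
  have h2 : s (p - 1) p (by lia) ≫ Z.d (p - 1) p = Z.iCycles p := by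
    rw [← Z.toCycles_i (p - 1) p, ← Category.assoc, hs, Category.id_comp]
  rw [Cochain.add_v, δ_v (-1) 0 (by norm_num) _ p p (by simp) (p - 1) (p + 1) (by lia) rfl]
  simp [h2, hr, ← h1]

lemma cobAll [EnoughProjectives C] (N : ℕ)
    (hN : ∀ M : C, HasProjectiveDimensionLT M (N + 1)) (X : CochainComplex C ℤ)
    (hX : ∀ n, Projective (X.X n)) (k : ℕ) : ∀ (Z : CochainComplex C ℤ), (∀ n, Z.ExactAt n) →
      (∀ n, HasProjectiveDimensionLT (Z.X n) (k + 1)) → CobAll X Z := by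
  induction k with
  | zero =>
    intro Z hZ hd
    obtain ⟨h⟩ := contractible_of_projective Z hZ (fun n => by
      have := hd n
      rw [zero_add] at this
      exact projective_iff_hasProjectiveDimensionLT_one.2 this) N hN
    exact cobAll_of_contractible X Z h
  | succ k ih =>
    intro Z hZ hd m n hmn c hc
    obtain ⟨P, q, hq, hP, ⟨hc0⟩⟩ := exists_cover Z
    have hS := shortExact_kernel q hq
    have hac := acyclic_X₁ _ hS (exactAt_of_contractible _ hc0) hZ
    have hK := ih _ hac (fun n =>
      ((hS.map_of_exact (HomologicalComplex.eval C (ComplexShape.up ℤ) n)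
        ).hasProjectiveDimensionLT_X₃_iff k (hP n)).1 (hd n))
    obtain ⟨b, hb, hbc⟩ := lift_cocycle X hX _ hS hK n c hc
    obtain ⟨a, ha⟩ := cobAll_of_contractible X P hc0 m n hmn b hb
    refine ⟨a.comp (Cochain.ofHom q) (add_zero _), ?_⟩
    rw [δ_comp_ofHom, ha]
    exact hbc

lemma ext_of_cobAll [HasExt.{w} (CochainComplex C ℤ)] [EnoughInjectives (CochainComplex C ℤ)]
    (X Z : CochainComplex C ℤ) (hX : ∀ n, Projective (X.X n)) (h : CobAll X Z) :
    Subsingleton (Ext.{w} X Z 1) := by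
  let S := ShortComplex.mk (Injective.ι Z) (cokernel.π (Injective.ι Z)) (cokernel.condition _)
  have hS : S.ShortExact :=
    { exact := ShortComplex.exact_cokernel _
      mono_f := inferInstanceAs (Mono (Injective.ι Z))
      epi_g := inferInstanceAs (Epi (cokernel.π (Injective.ι Z))) }
  suffices ∀ x : Ext.{w} X Z 1, x = 0 from ⟨fun a b => by rw [this a, this b]⟩
  intro x
  have : Injective S.X₂ := inferInstanceAs (Injective (Injective.under Z))
  obtain ⟨y, rfl⟩ := Ext.covariant_sequence_exact₁ X hS x
    (Ext.eq_zero_of_injective _) (zero_add 1)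
  obtain ⟨g, rfl⟩ := (Ext.mk₀_bijective _ _).2 y
  obtain ⟨b, hb, hbc⟩ := lift_cocycle X hX S hS h 0 (Cochain.ofHom g) (by simp)
  let t : X ⟶ S.X₂ := Cocycle.homOf (Cocycle.mk b 1 (zero_add 1) hb)
  have ht : t ≫ S.g = g := by
    apply Cochain.ofHom_injective
    rw [Cochain.ofHom_comp, ← hbc]
    congr 1
    exact Cocycle.cochain_ofHom_homOf_eq_coe _
  rw [← ht, ← Ext.mk₀_comp_mk₀, Ext.comp_assoc_of_second_deg_zero, hS.comp_extClass,
    Ext.comp_zero]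

lemma pd_of_resolution {M : C} (n : ℕ) (P : ProjectiveResolution M)
    (hP : ∀ i : ℕ, n < i → IsZero (P.complex.X i)) : HasProjectiveDimensionLT M (n + 1) := by
  let := HasExt.standard C
  rw [hasProjectiveDimensionLT_iff]
  intro i hi Y e
  obtain ⟨f, hf, rfl⟩ := P.extMk_surjective e (i + 1) rfl
  obtain rfl : f = 0 := (hP i (by lia)).eq_of_src _ _
  simp

end Stmt10Aux

/-- If `R` has finite left-global dimension, then in `Ch(R)` the class
`{X | Ext¹(X, Z) = 0 for all acyclic Z}` equals the class of complexes with projective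
components. -/
theorem stmt10 {R : Type u} [Ring R]
    [HasExt.{w} (CochainComplex (ModuleCat.{u} R) ℤ)]
    (hgl : ∃ n : ℕ, ∀ M : ModuleCat.{u} R, HasProjDimLE M n) :
    {X : CochainComplex (ModuleCat.{u} R) ℤ |
        ∀ Z : CochainComplex (ModuleCat.{u} R) ℤ, IsAcyclicComplex Z →
          Subsingleton (Ext.{w} X Z 1)} =
    {X : CochainComplex (ModuleCat.{u} R) ℤ | ∀ n : ℤ, Projective (X.X n)} := by
  obtain ⟨N, hN⟩ := hgl
  have hN' : ∀ M : ModuleCat.{u} R, HasProjectiveDimensionLT M (N + 1) := fun M => by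
    obtain ⟨P, hP⟩ := hN M
    exact Stmt10Aux.pd_of_resolution N P hP
  ext X
  constructor
  · intro hX n
    exact Stmt10Aux.projective_of_ext X hX n
  · intro hX Z hZ
    exact Stmt10Aux.ext_of_cobAll X Z hX
      (Stmt10Aux.cobAll N hN' X hX N Z hZ (fun n => hN' _))
end

section
/- Let R be a ring of finite left-global dimension, i.e. there exists n such that every left R-module has projective dimension at most n. Then in the abelian category Ch(R) of ℤ-indexed cochain complexes of left R-modules, the class {Y | Ext^1_{Ch(R)}(Z, Y) = 0 for every acyclic complex Z} equals the class of complexes all of whose components are injective R-modules. -/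
open CategoryTheory CategoryTheory.Limits CategoryTheory.Abelian

universe w u

universe v

namespace Stmt11Aux
open CochainComplex HomComplex

variable {C : Type u} [Category.{v} C] [Abelian C]

/-- Cocycles out of a contractible complex are coboundaries. -/
lemma cob_of_contr {Z Y : CochainComplex C ℤ} (h : Cochain Z Z (-1))
    (hh : δ (-1) 0 h = Cochain.ofHom (𝟙 Z)) (n m : ℤ) (hnm : n + 1 = m)
    (α : Cochain Z Y m) (hα : δ m (m + 1) α = 0) :
    ∃ β : Cochain Z Y n, δ n m β = α := by
  refine ⟨m.negOnePow • h.comp α (show -1 + m = n by lia), ?_⟩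
  rw [δ_units_smul, δ_comp h α (show -1 + m = n by lia) 0 (m + 1) m hnm (by lia) rfl, hα, hh]
  simp [smul_smul]

lemma epi_toCycles {Z : CochainComplex C ℤ} (hZ : Z.Acyclic) (p q : ℤ) (h : p + 1 = q) :
    Epi (Z.toCycles p q) := by
  have hq := hZ q
  rw [HomologicalComplex.exactAt_iff] at hq
  have := hq.epi_toCycles
  obtain rfl : p = (ComplexShape.up ℤ).prev q := by simp; lia
  exact this

lemma contr_of_projective_cycles {Z : CochainComplex C ℤ} (hZ : Z.Acyclic)
    (hP : ∀ n, Projective (Z.cycles n)) :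
    ∃ h : Cochain Z Z (-1), δ (-1) 0 h = Cochain.ofHom (𝟙 Z) := by
  have hs : ∀ (p q : ℤ) (_ : p + 1 = q), ∃ s : Z.cycles q ⟶ Z.X p, s ≫ Z.toCycles p q = 𝟙 _ := by
    intro p q h
    have := epi_toCycles hZ p q h
    exact ⟨Projective.factorThru (𝟙 _) _, Projective.factorThru_comp _ _⟩
  choose s hs using hs
  have hsd : ∀ p q h, s p q h ≫ Z.d p q = Z.iCycles q := by
    intro p q h
    rw [← Z.toCycles_i p q, reassoc_of% (hs p q h)]
  have hπ : ∀ q : ℤ, ∃ t : Z.X q ⟶ Z.cycles q,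
      t ≫ Z.iCycles q = 𝟙 _ - Z.toCycles q (q + 1) ≫ s q (q + 1) rfl := by
    intro q
    refine ⟨Z.liftCycles (𝟙 _ - Z.toCycles q (q + 1) ≫ s q (q + 1) rfl) (q + 1) (by simp) ?_,
      HomologicalComplex.liftCycles_i _ _ _ _ _⟩
    simp [Preadditive.sub_comp, hsd]
  choose t ht using hπ
  have hdt : ∀ p q, p + 1 = q → Z.d p q ≫ t q = Z.toCycles p q := by
    intro p q h
    rw [← cancel_mono (Z.iCycles q), Category.assoc, ht]
    simp [Preadditive.comp_sub]
  refine ⟨Cochain.mk (fun q p h => t q ≫ s p q (by lia)), ?_⟩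
  ext p
  rw [δ_v (-1) 0 (by simp) _ p p (by simp) (p - 1) (p + 1) rfl rfl]
  simp only [Cochain.mk_v, Category.assoc, hsd, ht]
  rw [reassoc_of% (hdt p (p + 1) rfl)]
  simp

/-- Extending a cochain to degreewise injectives along a degreewise mono. -/
lemma extend_cochain {K P Y : CochainComplex C ℤ} (i : K ⟶ P) [Mono i]
    (hY : ∀ n, Injective (Y.X n)) (n : ℤ) (g : Cochain K Y n) :
    ∃ g' : Cochain P Y n, (Cochain.ofHom i).comp g' (zero_add n) = g := by
  refine ⟨Cochain.mk (fun p q h => Injective.factorThru (g.v p q h) (i.f p)), ?_⟩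
  ext p q h
  simp

lemma step {S : ShortComplex (CochainComplex C ℤ)} (hS : S.ShortExact)
    {Y : CochainComplex C ℤ} (hY : ∀ n, Injective (Y.X n))
    (h1 : ∀ (n m : ℤ) (_ : n + 1 = m)
      (α : Cochain S.X₁ Y m), δ m (m + 1) α = 0 → ∃ β : Cochain S.X₁ Y n, δ n m β = α)
    (h2 : ∀ (n m : ℤ) (_ : n + 1 = m)
      (α : Cochain S.X₂ Y m), δ m (m + 1) α = 0 → ∃ β : Cochain S.X₂ Y n, δ n m β = α)
    (n m : ℤ) (hnm : n + 1 = m)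
    (α : Cochain S.X₃ Y m) (hα : δ m (m + 1) α = 0) :
    ∃ β : Cochain S.X₃ Y n, δ n m β = α := by
  have := hS.mono_f
  have := hS.epi_g
  obtain ⟨b, hb⟩ := h2 n m hnm ((Cochain.ofHom S.g).comp α (zero_add m)) (by
    rw [δ_ofHom_comp, hα, Cochain.comp_zero])
  obtain ⟨g, hg⟩ := h1 (n - 1) n (by lia) ((Cochain.ofHom S.f).comp b (zero_add n)) (by
    obtain rfl := hnm
    rw [δ_ofHom_comp, hb, ← Cochain.comp_assoc_of_first_is_zero_cochain, ← Cochain.ofHom_comp,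
      S.zero, Cochain.ofHom_zero, Cochain.zero_comp])
  obtain ⟨g', hg'⟩ := extend_cochain S.f hY _ g
  have hk : (Cochain.ofHom S.f).comp (b - δ (n - 1) n g') (zero_add n) = 0 := by
    rw [Cochain.comp_sub, ← δ_ofHom_comp, hg', hg, sub_self]
  have hex : ∀ p, (S.map (HomologicalComplex.eval C _ p)).ShortExact := fun p =>
    hS.map_of_exact _
  have hd : ∀ p q (h : p + n = q), ∃ c : S.X₃.X p ⟶ Y.X q,
      S.g.f p ≫ c = (b - δ (n - 1) n g').v p q h := by
    intro p q h
    have := (hex p).epi_g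
    refine ⟨(hex p).exact.desc ((b - δ (n - 1) n g').v p q h) ?_, (hex p).exact.g_desc _ _⟩
    have : S.f.f p ≫ (b - δ (n - 1) n g').v p q h = 0 := by
      simpa [Preadditive.comp_sub] using Cochain.congr_v hk p q h
    exact this
  choose c hc using hd
  refine ⟨Cochain.mk c, ?_⟩
  have e : (Cochain.ofHom S.g).comp (Cochain.mk c) (zero_add n) = b - δ (n - 1) n g' := by
    ext p q h
    simp [hc]
  have e2 : (Cochain.ofHom S.g).comp (δ n m (Cochain.mk c)) (zero_add m) =
      (Cochain.ofHom S.g).comp α (zero_add m) := by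
    rw [← δ_ofHom_comp, e, δ_sub, δ_δ, sub_zero, hb]
  ext p q h
  have := Cochain.congr_v e2 p q h
  simpa [cancel_epi] using this

lemma acyclic_of_contr {P : CochainComplex C ℤ} (h : Cochain P P (-1))
    (hh : δ (-1) 0 h = Cochain.ofHom (𝟙 P)) : P.Acyclic := by
  have ho : Homotopy (𝟙 P) 0 := (Cochain.equivHomotopy _ _).symm ⟨h, by simp [hh]⟩
  intro n
  rw [HomologicalComplex.exactAt_iff_isZero_homology, IsZero.iff_id_eq_zero,
    ← HomologicalComplex.homologyMap_id, ho.homologyMap_eq, HomologicalComplex.homologyMap_zero]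

lemma projective_cycles_of_contr {P : CochainComplex C ℤ} (h : Cochain P P (-1))
    (hh : δ (-1) 0 h = Cochain.ofHom (𝟙 P)) (hP : ∀ n, Projective (P.X n)) (n : ℤ) :
    Projective (P.cycles n) := by
  have := hP n
  refine Retract.projective (Y := P.X n) ⟨P.iCycles n, h.v n (n - 1) (by lia) ≫ P.toCycles (n - 1) n, ?_⟩
  rw [← cancel_mono (P.iCycles n)]
  have := Cochain.congr_v hh n n (by simp)
  rw [δ_v (-1) 0 (by simp) _ n n (by simp) (n - 1) (n + 1) rfl rfl] at this
  have := P.iCycles n ≫= this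
  simpa using this


lemma cone_contr (Q : CochainComplex C ℤ) :
    δ (-1) 0 ((mappingCone.snd (𝟙 Q)).comp (mappingCone.inl (𝟙 Q)) (zero_add (-1))) =
      Cochain.ofHom (𝟙 (mappingCone (𝟙 Q))) := by
  rw [δ_comp _ _ (zero_add (-1)) 1 0 0 (by simp) (by simp) (by simp), mappingCone.δ_inl,
    mappingCone.δ_snd, ← mappingCone.id, Category.id_comp, Cochain.comp_id, Cochain.neg_comp,
    Int.negOnePow_odd (-1) (by decide), Units.neg_smul, one_smul, neg_neg, add_comm]

lemma cone_projective (Q : CochainComplex C ℤ) (hQ : ∀ n, Projective (Q.X n)) (n : ℤ) :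
    Projective ((mappingCone (𝟙 Q)).X n) :=
  Projective.of_iso (HomologicalComplex.homotopyCofiber.XIsoBiprod (𝟙 Q) n (n + 1) rfl).symm
    inferInstance

/-- A cochain of degree `-1` out of `Q` induces a morphism from the cone of the identity. -/
lemma exists_desc {Q Z : CochainComplex C ℤ} (α : Cochain Q Z (-1)) :
    ∃ f : mappingCone (𝟙 Q) ⟶ Z, ∀ p q (h : p + (-1) = q),
      (mappingCone.inl (𝟙 Q)).v p q h ≫ f.f q = α.v p q h := by
  let β : Q ⟶ Z := Cocycle.homOf (Cocycle.mk (δ (-1) 0 α) 1 (zero_add 1) (δ_δ _ _ _ _))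
  have hβ : δ (-1) 0 α = Cochain.ofHom (𝟙 Q ≫ β) := by
    rw [Category.id_comp, Cocycle.cochain_ofHom_homOf_eq_coe]; rfl
  exact ⟨mappingCone.desc (𝟙 Q) α β hβ, fun p q h => mappingCone.inl_v_desc_f _ _ _ _ _ _ _⟩

/-- A degreewise map to `Y` induces a morphism to the cone of the identity. -/
lemma exists_lift {K Y : CochainComplex C ℤ} (β : Cochain K Y 0) :
    ∃ f : K ⟶ mappingCone (𝟙 Y),
      (Cochain.ofHom f).comp (mappingCone.snd (𝟙 Y)) (add_zero 0) = β ∧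
      (Cochain.ofHom f).comp (mappingCone.fst (𝟙 Y)).1 (zero_add 1) = - δ 0 1 β := by
  let α : Cocycle K Y 1 := Cocycle.mk (- δ 0 1 β) 2 (by lia) (by rw [δ_neg, δ_δ, neg_zero])
  have hα : α.1 = - δ 0 1 β := rfl
  refine ⟨mappingCone.lift (𝟙 Y) α β (by rw [hα, Cochain.comp_id, add_neg_cancel]), ?_, ?_⟩
  · rw [mappingCone.ofHom_lift, mappingCone.liftCochain_snd]
  · rw [mappingCone.ofHom_lift, mappingCone.liftCochain_fst, hα]

lemma hom_cone_ext {K Y : CochainComplex C ℤ} {f g : K ⟶ mappingCone (𝟙 Y)}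
    (h : (Cochain.ofHom f).comp (mappingCone.snd (𝟙 Y)) (add_zero 0) =
      (Cochain.ofHom g).comp (mappingCone.snd (𝟙 Y)) (add_zero 0)) : f = g := by
  have key : ∀ f : K ⟶ mappingCone (𝟙 Y),
      (Cochain.ofHom f).comp (mappingCone.fst (𝟙 Y)).1 (zero_add 1) =
      - δ 0 1 ((Cochain.ofHom f).comp (mappingCone.snd (𝟙 Y)) (add_zero 0)) := by
    intro f
    rw [δ_ofHom_comp, mappingCone.δ_snd, Cochain.comp_id, Cochain.comp_neg, neg_neg]
  apply Cochain.ofHom_injective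
  rw [mappingCone.ext_cochain_to_iff (𝟙 Y) 0 1 (zero_add 1)]
  exact ⟨by rw [key, key, h], h⟩

lemma cone_injective (Y : CochainComplex C ℤ) (hY : ∀ n, Injective (Y.X n)) :
    Injective (mappingCone (𝟙 Y)) where
  factors {K L} g i _ := by
    obtain ⟨b, hb⟩ := extend_cochain i hY 0
      ((Cochain.ofHom g).comp (mappingCone.snd (𝟙 Y)) (add_zero 0))
    obtain ⟨f, hf, -⟩ := exists_lift b
    refine ⟨f, hom_cone_ext ?_⟩
    rw [Cochain.ofHom_comp, Cochain.comp_assoc_of_first_is_zero_cochain, hf, hb]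

section
variable [EnoughProjectives C]

lemma exists_cover (Z : CochainComplex C ℤ) : ∃ (P : CochainComplex C ℤ) (p : P ⟶ Z)
    (h : Cochain P P (-1)), Epi p ∧ δ (-1) 0 h = Cochain.ofHom (𝟙 P) ∧
      ∀ n, Projective (P.X n) := by
  let Q : CochainComplex C ℤ :=
    { X := fun i => Projective.over (Z.X (i - 1)), d := fun _ _ => 0 }
  let α : Cochain Q Z (-1) := Cochain.mk (fun p q h =>
    Projective.π (Z.X (p - 1)) ≫ eqToHom (by congr 1))
  obtain ⟨f, hf⟩ := exists_desc α
  refine ⟨mappingCone (𝟙 Q), f, _, ?_, cone_contr Q, cone_projective Q fun n => ?_⟩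
  · have : ∀ n, Epi (f.f n) := by
      intro n
      have hn : n + 1 + (-1) = n := by omega
      have : Epi ((mappingCone.inl (𝟙 Q)).v (n + 1) n hn ≫ f.f n) := by
        rw [hf]
        dsimp [α]
        infer_instance
      exact epi_of_epi ((mappingCone.inl (𝟙 Q)).v (n + 1) n hn) _
    exact HomologicalComplex.epi_of_epi_f _ this
  · dsimp [Q]; infer_instance

lemma cob {Y : CochainComplex C ℤ} (hY : ∀ n, Injective (Y.X n)) (k : ℕ) :
    ∀ (Z : CochainComplex C ℤ), Z.Acyclic → (∀ n, HasProjectiveDimensionLT (Z.cycles n) (k + 1)) →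
    ∀ (n m : ℤ) (_ : n + 1 = m)
      (α : Cochain Z Y m), δ m (m + 1) α = 0 → ∃ β : Cochain Z Y n, δ n m β = α := by
  induction k with
  | zero =>
    intro Z hZ hd
    obtain ⟨h, hh⟩ := contr_of_projective_cycles hZ
      (fun n => by rw [projective_iff_hasProjectiveDimensionLT_one]; exact hd n)
    exact fun n m hnm α hα => cob_of_contr h hh n m hnm α hα
  | succ k ih =>
    intro Z hZ hd
    obtain ⟨P, p, h, hp, hh, hP⟩ := exists_cover Z
    let S : ShortComplex (CochainComplex C ℤ) := ShortComplex.mk _ _ (kernel.condition p)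
    have hS : S.ShortExact := { exact := ShortComplex.exact_kernel p }
    have hPa : S.X₂.Acyclic := acyclic_of_contr h hh
    have hq : QuasiIso S.g := ⟨fun n => by
      rw [quasiIsoAt_iff_exactAt _ _ (hPa n)]; exact hZ n⟩
    have hK : S.X₁.Acyclic := hS.acyclic_X₁ hq
    refine step hS hY (ih _ hK fun n => ?_) (fun n m hnm α hα => cob_of_contr h hh n m hnm α hα)
    have := hS.mono_f
    have := hS.epi_g
    have hex := HomologicalComplex.cycles_left_exact S hS.exact n
    have he : Epi (HomologicalComplex.cyclesMap S.g n) := by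
      have := epi_toCycles hZ (n - 1) n (by lia)
      have h2 : Epi (S.X₂.toCycles (n - 1) n ≫ HomologicalComplex.cyclesMap S.g n) := by
        have : S.X₂.toCycles (n - 1) n ≫ HomologicalComplex.cyclesMap S.g n =
          S.g.f (n - 1) ≫ S.X₃.toCycles (n - 1) n := by
          simp [← cancel_mono (S.X₃.iCycles n)]
        rw [this]
        have : Epi (S.X₃.toCycles (n - 1) n) := epi_toCycles hZ (n - 1) n (by lia)
        infer_instance
      exact epi_of_epi (S.X₂.toCycles (n - 1) n) _
    have hse : (ShortComplex.mk (HomologicalComplex.cyclesMap S.f n)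
      (HomologicalComplex.cyclesMap S.g n)
      (by rw [← HomologicalComplex.cyclesMap_comp, S.zero,
        HomologicalComplex.cyclesMap_zero])).ShortExact := { exact := hex }
    exact (hse.hasProjectiveDimensionLT_X₃_iff k (projective_cycles_of_contr h hh hP n)).1 (hd n)

end

/-- The connecting map of the cone of the identity. -/
noncomputable def conn (Y : CochainComplex C ℤ) : mappingCone (𝟙 Y) ⟶ Y⟦(1 : ℤ)⟧ :=
  Cocycle.homOf ((-mappingCone.fst (𝟙 Y)).rightShift 1 0 (zero_add 1))

lemma conn_f (Y : CochainComplex C ℤ) (n : ℤ) : (conn Y).f n =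
    - (mappingCone.fst (𝟙 Y)).1.v n (n + 1) rfl ≫
        (Y.shiftFunctorObjXIso 1 n (n + 1) rfl).inv := by
  rw [conn, Cocycle.homOf_f, Cocycle.rightShift_coe,
    Cochain.rightShift_v _ 1 0 _ n n (add_zero n) (n + 1) rfl, Cocycle.coe_neg, Cochain.neg_v,
    Preadditive.neg_comp]

lemma lift_mor₃ {Y Z : CochainComplex C ℤ}
    (hcob : ∀ (α : Cochain Z Y 1), δ 1 2 α = 0 → ∃ β : Cochain Z Y 0, δ 0 1 β = α)
    (f : Z ⟶ Y⟦(1 : ℤ)⟧) :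
    ∃ l : Z ⟶ mappingCone (𝟙 Y), l ≫ conn Y = f := by
  obtain ⟨β, hβ⟩ := hcob ((Cochain.ofHom f).rightUnshift 1 (zero_add 1)) (by
    rw [Cochain.δ_rightUnshift _ _ _ 2 1 (by lia)]; simp)
  obtain ⟨l, -, hl⟩ := exists_lift β
  refine ⟨l, ?_⟩
  ext n
  have := Cochain.congr_v (hl.trans (congrArg Neg.neg hβ)) n (n + 1) rfl
  rw [Cochain.neg_v, Cochain.rightUnshift_v _ _ _ _ _ _ n (add_zero n)] at this
  rw [Cochain.zero_cochain_comp_v] at this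
  simp only [Cochain.ofHom_v] at this
  rw [HomologicalComplex.comp_f, conn_f, Preadditive.comp_neg, ← Category.assoc, this,
    Preadditive.neg_comp, Category.assoc, Iso.hom_inv_id, Category.comp_id, neg_neg]

lemma ext_one (Y Z : CochainComplex C ℤ) [HasExt.{w} (CochainComplex C ℤ)]
    (hY : ∀ n, Injective (Y.X n))
    (hcob : ∀ (α : Cochain Z Y 1), δ 1 2 α = 0 → ∃ β : Cochain Z Y 0, δ 0 1 β = α) :
    Subsingleton (Ext.{w} Z Y 1) := by
  have hI := cone_injective Y hY
  let S := mappingCone.triangleRotateShortComplex (𝟙 Y)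
  have hS : S.ShortExact := HomologicalComplex.shortExact_of_degreewise_shortExact _
    (fun n => (mappingCone.triangleRotateShortComplexSplitting (𝟙 Y) n).shortExact)
  have : ∀ x : Ext Z S.X₁ 1, x = 0 := by
    intro x
    obtain ⟨x₃, rfl⟩ := Ext.covariant_sequence_exact₁ Z hS x
      (Ext.eq_zero_of_injective (I := mappingCone (𝟙 Y)) _) (zero_add 1)
    obtain ⟨f, rfl⟩ := (Ext.mk₀_bijective _ _).2 x₃
    obtain ⟨l, rfl⟩ : ∃ l : Z ⟶ S.X₂, l ≫ S.g = f := by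
      exact lift_mor₃ hcob f
    rw [← Ext.mk₀_comp_mk₀, Ext.comp_assoc_of_second_deg_zero, hS.comp_extClass, Ext.comp_zero]
  exact ⟨fun a b => (this a).trans (this b).symm⟩

lemma cone_acyclic (Q : CochainComplex C ℤ) : (mappingCone (𝟙 Q)).Acyclic :=
  acyclic_of_contr _ (cone_contr Q)

lemma exists_cone_map {A B : CochainComplex C ℤ} (φ : A ⟶ B) [Mono φ] :
    ∃ m : mappingCone (𝟙 A) ⟶ mappingCone (𝟙 B), Mono m ∧ ∀ p q (h : p + (-1) = q),
      (mappingCone.inl (𝟙 A)).v p q h ≫ m.f q = φ.f p ≫ (mappingCone.inl (𝟙 B)).v p q h := by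
  let m := mappingCone.map (𝟙 A) (𝟙 B) φ φ (by simp)
  have hm : ∀ n, m.f n ≫ (mappingCone.snd (𝟙 B)).v n n (add_zero n) =
      (mappingCone.snd (𝟙 A)).v n n (add_zero n) ≫ φ.f n := by
    intro n
    rw [mappingCone.ext_from_iff (𝟙 A) (n + 1) n rfl]
    simp [m, mappingCone.map]
  refine ⟨m, ⟨fun {K} f g hfg => hom_cone_ext ?_⟩, ?_⟩
  · ext n
    have := congrArg (fun t => t.f n ≫ (mappingCone.snd (𝟙 B)).v n n (add_zero n)) hfg
    simp only [HomologicalComplex.comp_f, Category.assoc, hm] at this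
    simp only [← Category.assoc, cancel_mono] at this
    simpa using this
  · intro p q h
    simp [m, mappingCone.map]

lemma injective_of_ext [HasExt.{w} (CochainComplex C ℤ)] (Y : CochainComplex C ℤ)
    (hY : ∀ Z : CochainComplex C ℤ, Z.Acyclic → Subsingleton (Ext.{w} Z Y 1)) (n : ℤ) :
    Injective (Y.X n) where
  factors {A B} g i _ := by
    let sA := (HomologicalComplex.single C (ComplexShape.up ℤ) (n + 1)).obj A
    let sB := (HomologicalComplex.single C (ComplexShape.up ℤ) (n + 1)).obj B
    let φ : sA ⟶ sB := (HomologicalComplex.single C (ComplexShape.up ℤ) (n + 1)).map i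
    have : Mono φ := by dsimp [φ]; infer_instance
    obtain ⟨m, hm, hm'⟩ := exists_cone_map φ
    let S : ShortComplex (CochainComplex C ℤ) := ShortComplex.mk _ _ (cokernel.condition m)
    have hS : S.ShortExact := { exact := ShortComplex.exact_cokernel m }
    have hA : S.X₁.Acyclic := cone_acyclic _
    have hB : S.X₂.Acyclic := cone_acyclic _
    have hq : QuasiIso S.f := ⟨fun n => by
      rw [quasiIsoAt_iff_exactAt _ _ (hA n)]; exact hB n⟩
    have := hY _ (hS.acyclic_X₃ hq)
    have hn : n + 1 + (-1) = n := by omega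
    let α : Cochain sA Y (-1) := Cochain.mk fun p q h =>
      if hp : p = n + 1 then
        (HomologicalComplex.XIsoOfEq sA hp).hom ≫
          (HomologicalComplex.singleObjXSelf (ComplexShape.up ℤ) (n + 1) A).hom ≫ g ≫
          (HomologicalComplex.XIsoOfEq Y (show n = q by omega)).hom
      else 0
    have hα : α.v (n + 1) n hn =
        (HomologicalComplex.singleObjXSelf (ComplexShape.up ℤ) (n + 1) A).hom ≫ g := by
      simp [α]
    obtain ⟨F, hF⟩ := exists_desc α
    obtain ⟨x, hx⟩ := Ext.contravariant_sequence_exact₁ hS Y (Ext.mk₀ F) (add_zero 1)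
      (Subsingleton.elim _ _)
    obtain ⟨G, rfl⟩ := (Ext.mk₀_bijective _ _).2 x
    rw [Ext.mk₀_comp_mk₀] at hx
    have hx' : m ≫ G = F := (Ext.mk₀_bijective _ _).1 hx
    refine ⟨(HomologicalComplex.singleObjXSelf (ComplexShape.up ℤ) (n + 1) B).inv ≫
      (mappingCone.inl (𝟙 sB)).v (n + 1) n hn ≫ HomologicalComplex.Hom.f G n, ?_⟩
    have h1 := hF (n + 1) n hn
    rw [hα, ← hx', HomologicalComplex.comp_f, reassoc_of% (hm' (n + 1) n hn)] at h1
    rw [← cancel_epi (HomologicalComplex.singleObjXSelf (ComplexShape.up ℤ) (n + 1) A).hom, ← h1]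
    simp [φ, HomologicalComplex.single_map_f_self]

lemma pd_of_resolution {M : C} (n : ℕ) (P : ProjectiveResolution M)
    (hP : ∀ i : ℕ, n < i → IsZero (P.complex.X i)) : HasProjectiveDimensionLT M (n + 1) := by
  let := HasExt.standard C
  rw [hasProjectiveDimensionLT_iff]
  intro i hi Y e
  obtain ⟨f, hf, rfl⟩ := P.extMk_surjective e (i + 1) rfl
  obtain rfl : f = 0 := (hP i (by lia)).eq_of_src _ _
  exact P.extMk_zero _ _

end Stmt11Aux

theorem stmt11 {R : Type u} [Ring R]
    [HasExt.{w} (CochainComplex (ModuleCat.{u} R) ℤ)]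
    (hgl : ∃ n : ℕ, ∀ M : ModuleCat.{u} R, HasProjDimLE M n) :
    {Y : CochainComplex (ModuleCat.{u} R) ℤ |
        ∀ Z : CochainComplex (ModuleCat.{u} R) ℤ, IsAcyclicComplex Z →
          Subsingleton (Ext.{w} Z Y 1)} =
    {Y : CochainComplex (ModuleCat.{u} R) ℤ | ∀ n : ℤ, Injective (Y.X n)} := by
  obtain ⟨n, hn⟩ := hgl
  ext Y
  constructor
  · intro hY
    exact Stmt11Aux.injective_of_ext Y hY
  · intro hY Z hZ
    refine Stmt11Aux.ext_one Y Z hY (Stmt11Aux.cob hY n Z hZ (fun i => ?_) 0 1 (zero_add 1))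
    obtain ⟨P, hP⟩ := hn (Z.cycles i)
    exact Stmt11Aux.pd_of_resolution n P hP
end

section
/- Let R be a Gorenstein ring, i.e. R is left and right Noetherian and R has finite injective dimension both as a left and as a right module over itself. Let P be an acyclic ℤ-indexed cochain complex of projective left R-modules and let X be a cochain complex of left R-modules. If either (1) X is a bounded-below complex all of whose components are projective, or (2) X is a bounded-above acyclic complex, then Ext^1_{Ch(R)}(P, X) = 0. -/
open CategoryTheory CategoryTheory.Limits CategoryTheory.Abelian

universe w u

/-- An `R`-module `M` has injective dimension at most `n`: it admits an injective
resolution vanishing in degrees above `n`. -/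
def HasInjDimLE {R : Type u} [Ring R] (M : ModuleCat.{u} R) (n : ℕ) : Prop :=
  ∃ I : InjectiveResolution M, ∀ i : ℕ, n < i → IsZero (I.cocomplex.X i)

namespace Stmt12Aux

universe v

lemma build {ι : Type*} {A : ι → Type*} (lvl : ι → ℕ) (V : ℕ → (∀ i, A i) → Prop)
    (h0 : ∃ s, V 0 s)
    (step : ∀ k s, V k s → ∃ s', V (k + 1) s' ∧ ∀ i, lvl i ≤ k → s' i = s i) :
    ∃ t : ∀ i, A i, ∀ k, ∃ s, V k s ∧ ∀ i, lvl i ≤ k → t i = s i := by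
  classical
  obtain ⟨s0, hs0⟩ := h0
  choose f hf1 hf2 using step
  let F : ∀ k : ℕ, {s : ∀ i, A i // V k s} := fun k =>
    Nat.rec ⟨s0, hs0⟩ (fun k s => ⟨f k s.1 s.2, hf1 k s.1 s.2⟩) k
  have hF : ∀ k i, lvl i ≤ k → (F (k + 1)).1 i = (F k).1 i := fun k i hi =>
    hf2 k (F k).1 (F k).2 i hi
  have hF' : ∀ k i, lvl i ≤ k → (F k).1 i = (F (lvl i)).1 i := by
    intro k i hi
    induction k, hi using Nat.le_induction with
    | base => rfl
    | succ k hk ih => rw [hF k i hk, ih]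
  exact ⟨fun i => (F (lvl i)).1 i, fun k => ⟨(F k).1, (F k).2, fun i hi => (hF' k i hi).symm⟩⟩

section

variable {C : Type*} [Category.{v} C] [Abelian C]

/-- The relation making `s` a (twisted) nullhomotopy of `φ` at degree `n`. -/
def Rel {P X : CochainComplex C ℤ} (φ : ∀ i j : ℤ, P.X i ⟶ X.X j) (n : ℤ)
    (s : ∀ n : ℤ, P.X n ⟶ X.X n) : Prop :=
  ∀ j, n + 1 = j → φ n j = s n ≫ X.d n j - P.d n j ≫ s j

lemma homotopy_up (P X : CochainComplex C ℤ) (φ : ∀ i j : ℤ, P.X i ⟶ X.X j)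
    (hφ : ∀ i j k : ℤ, φ i j ≫ X.d j k + P.d i j ≫ φ j k = 0)
    (N : ℤ) (hN : ∀ n : ℤ, n < N → IsZero (X.X n))
    (hE : ∀ i j k l : ℤ, i + 1 = j → j + 1 = k → ∀ g : P.X j ⟶ X.X l, P.d i j ≫ g = 0 →
      ∃ h : P.X k ⟶ X.X l, P.d j k ≫ h = g) :
    ∃ s : ∀ n : ℤ, P.X n ⟶ X.X n, ∀ n, Rel φ n s := by
  classical
  obtain ⟨t, ht⟩ := build (A := fun n : ℤ => (P.X n ⟶ X.X n)) (fun n => (n - (N - 1)).toNat)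
    (fun k s => ∀ n, n < N - 1 + k → Rel φ n s)
    ⟨fun n => 0, by
      intro n hn j hj
      exact (hN j (by simp at hn; lia)).eq_of_tgt _ _⟩
    (by
      intro k s hs
      set m : ℤ := N - 1 + k with hm
      obtain ⟨c, hc⟩ := hE (m - 1) m (m + 1) (m + 1) (by lia) rfl
        (s m ≫ X.d m (m + 1) - φ m (m + 1)) (by
          have h1 := hs (m - 1) (by lia) m (by lia)
          have h2 := hφ (m - 1) m (m + 1)
          rw [h1] at h2
          simp only [Preadditive.sub_comp, Category.assoc, HomologicalComplex.d_comp_d,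
            comp_zero, zero_sub] at h2
          rw [Preadditive.comp_sub, ← neg_eq_zero, ← h2]
          abel)
      refine ⟨Function.update s (m + 1) c, ?_, ?_⟩
      · intro n hn j hj
        rcases lt_or_eq_of_le (show n ≤ m by push_cast at hn; lia) with h | h
        · rw [Function.update_of_ne (by lia), Function.update_of_ne (by lia)]
          exact hs n h j hj
        · subst hj
          rw [h, Function.update_of_ne (by lia), Function.update_self, hc]
          abel
      · intro i hi
        rw [Function.update_of_ne]
        lia)
  refine ⟨t, fun n j hj => ?_⟩
  obtain ⟨s, hs, hst⟩ := ht (n + 1 - (N - 1)).toNat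
  rw [hst n (by lia), hst j (by lia)]
  exact hs n (by lia) j hj

lemma homotopy_down (P X : CochainComplex C ℤ) (φ : ∀ i j : ℤ, P.X i ⟶ X.X j)
    (hφ : ∀ i j k : ℤ, φ i j ≫ X.d j k + P.d i j ≫ φ j k = 0)
    (N : ℤ) (hN : ∀ n : ℤ, N < n → IsZero (X.X n))
    (hE : ∀ i j k l : ℤ, i + 1 = j → j + 1 = k → ∀ g : P.X l ⟶ X.X j, g ≫ X.d j k = 0 →
      ∃ h : P.X l ⟶ X.X i, h ≫ X.d i j = g) :
    ∃ s : ∀ n : ℤ, P.X n ⟶ X.X n, ∀ n, Rel φ n s := by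
  classical
  obtain ⟨t, ht⟩ := build (A := fun n : ℤ => (P.X n ⟶ X.X n)) (fun n => (N - n + 1).toNat)
    (fun k s => ∀ n, N - k < n → Rel φ n s)
    ⟨fun n => 0, by
      intro n hn j hj
      exact (hN j (by simp at hn; lia)).eq_of_tgt _ _⟩
    (by
      intro k s hs
      set m : ℤ := N - k with hm
      obtain ⟨c, hc⟩ := hE m (m + 1) (m + 2) m rfl (by lia)
        (φ m (m + 1) + P.d m (m + 1) ≫ s (m + 1)) (by
          have h1 := hs (m + 1) (by lia) (m + 2) (by lia)
          have h2 := hφ m (m + 1) (m + 2)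
          rw [h1] at h2
          simp only [Preadditive.comp_sub, HomologicalComplex.d_comp_d_assoc,
            zero_comp, sub_zero] at h2
          rw [Preadditive.add_comp, Category.assoc, h2])
      refine ⟨Function.update s m c, ?_, ?_⟩
      · intro n hn j hj
        rcases lt_or_eq_of_le (show m ≤ n by push_cast at hn; lia) with h | h
        · rw [Function.update_of_ne (by lia), Function.update_of_ne (by lia)]
          exact hs n h j hj
        · subst hj
          subst h
          rw [Function.update_self, Function.update_of_ne (by lia), hc]
          abel
      · intro i hi
        rw [Function.update_of_ne]
        lia)
  refine ⟨t, fun n j hj => ?_⟩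
  obtain ⟨s, hs, hst⟩ := ht (N - n + 1).toNat
  rw [hst n (by lia), hst j (by lia)]
  exact hs n (by lia) j hj

lemma subsingleton_ext_one [EnoughInjectives (CochainComplex C ℤ)]
    [HasExt.{w} (CochainComplex C ℤ)] (P X : CochainComplex C ℤ)
    (hP : ∀ n : ℤ, Projective (P.X n))
    (H : ∀ φ : ∀ i j : ℤ, P.X i ⟶ X.X j,
      (∀ i j k : ℤ, φ i j ≫ X.d j k + P.d i j ≫ φ j k = 0) →
      ∃ s : ∀ n : ℤ, P.X n ⟶ X.X n, ∀ n, Rel φ n s) :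
    Subsingleton (Ext.{w} P X 1) := by
  refine subsingleton_of_forall_eq 0 fun x => ?_
  let S : ShortComplex (CochainComplex C ℤ) :=
    ShortComplex.mk (Injective.ι X) (cokernel.π (Injective.ι X)) (by simp)
  have hS : S.ShortExact :=
    { exact := ShortComplex.exact_cokernel _
      mono_f := by dsimp [S]; infer_instance
      epi_g := by dsimp [S]; infer_instance }
  have : Injective S.X₂ := by dsimp [S]; infer_instance
  obtain ⟨x₃, hx₃⟩ := Ext.covariant_sequence_exact₁ P hS (x : Ext P S.X₁ 1)
    (Ext.eq_zero_of_hasInjectiveDimensionLT _ 1 le_rfl) (zero_add 1)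
  obtain ⟨g, rfl⟩ := (Ext.mk₀_bijective P S.X₃).2 x₃
  suffices hl : ∃ l : P ⟶ S.X₂, l ≫ S.g = g by
    obtain ⟨l, rfl⟩ := hl
    rw [← hx₃, ← Ext.mk₀_comp_mk₀, Ext.comp_assoc_of_second_deg_zero, hS.comp_extClass,
      Ext.comp_zero]
  have hSn : ∀ n : ℤ, (S.map (HomologicalComplex.eval C (ComplexShape.up ℤ) n)).ShortExact :=
    fun n => hS.map_of_exact _
  have hg : ∀ n, ∃ h : P.X n ⟶ S.X₂.X n, h ≫ S.g.f n = g.f n := by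
    intro n
    have : Epi (S.g.f n) := (hSn n).epi_g
    have := hP n
    exact ⟨Projective.factorThru (g.f n) (S.g.f n), Projective.factorThru_comp _ _⟩
  choose h hh using hg
  have hm : ∀ n, Mono (S.f.f n) := fun n => (hSn n).mono_f
  have hphi : ∀ i j : ℤ, ∃ φ : P.X i ⟶ S.X₁.X j,
      φ ≫ S.f.f j = h i ≫ S.X₂.d i j - P.d i j ≫ h j := by
    intro i j
    have := (hSn j).mono_f
    have hz : (h i ≫ S.X₂.d i j - P.d i j ≫ h j) ≫ S.g.f j = 0 := by
      rw [Preadditive.sub_comp, Category.assoc, Category.assoc, hh, ← S.g.comm, reassoc_of% hh,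
        g.comm, sub_self]
    exact ⟨(hSn j).exact.lift _ hz, (hSn j).exact.lift_f _ hz⟩
  choose φ hφ using hphi
  obtain ⟨s, hs⟩ := H φ (by
    intro i j k
    have := hm k
    rw [← cancel_mono (S.f.f k)]
    change (φ i j ≫ S.X₁.d j k + P.d i j ≫ φ j k) ≫ _ = _
    rw [Preadditive.add_comp, Category.assoc, Category.assoc, ← S.f.comm, hφ,
      reassoc_of% hφ]
    simp)
  refine ⟨{ f := fun n => h n - s n ≫ S.f.f n, comm' := ?_ }, ?_⟩
  · intro i j hij
    have h1 : _ = _ ≫ S.X₁.d i j - _ := hs i j hij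
    have h2 := hφ i j
    rw [h1] at h2
    simp only [Preadditive.sub_comp, Preadditive.comp_sub, Category.assoc] at h2 ⊢
    rw [S.f.comm i j, sub_eq_sub_iff_add_eq_add, ← sub_eq_zero]
    rw [← sub_eq_zero] at h2
    rw [← neg_eq_zero, ← h2]
    abel
  · ext n
    have : S.f.f n ≫ S.g.f n = 0 := by
      rw [← HomologicalComplex.comp_f, S.zero]; rfl
    simp [Preadditive.sub_comp, this, hh]

lemma ext_prop [EnoughInjectives C] (P : CochainComplex C ℤ) (hP : ∀ n : ℤ, Projective (P.X n))
    (hA : ∀ n : ℤ, P.ExactAt n) (n : ℕ) : ∀ (Q : C), HasInjectiveDimensionLT Q (n + 1) →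
    ∀ i j k : ℤ, i + 1 = j → j + 1 = k → ∀ g : P.X j ⟶ Q, P.d i j ≫ g = 0 →
      ∃ h : P.X k ⟶ Q, P.d j k ≫ h = g := by
  induction n with
  | zero =>
    intro Q hQ i j k hij hjk g hg
    have hQ : HasInjectiveDimensionLT Q 1 := hQ
    have : Injective Q := injective_iff_hasInjectiveDimensionLT_one.2 hQ
    have hex : (P.sc' i j k).Exact :=
      (P.exactAt_iff' i j k (by simp; lia) (by simp; lia)).1 (hA j)
    exact ⟨hex.descToInjective g hg, hex.comp_descToInjective g hg⟩
  | succ n ih =>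
    intro Q hQ i j k hij hjk g hg
    let S : ShortComplex C :=
      ShortComplex.mk (Injective.ι Q) (cokernel.π (Injective.ι Q)) (by simp)
    have hS : S.ShortExact :=
      { exact := ShortComplex.exact_cokernel _
        mono_f := by dsimp [S]; infer_instance
        epi_g := by dsimp [S]; infer_instance }
    have hI : Injective S.X₂ := by dsimp [S]; infer_instance
    have h3 := (hS.hasInjectiveDimensionLT_X₃_iff n hI).2 hQ
    have hex : (P.sc' i j k).Exact :=
      (P.exactAt_iff' i j k (by simp; lia) (by simp; lia)).1 (hA j)
    have hz : (P.sc' i j k).f ≫ g ≫ S.f = 0 := by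
      change P.d i j ≫ g ≫ S.f = 0
      rw [reassoc_of% hg, zero_comp]
    obtain ⟨h, hh⟩ : ∃ h : P.X k ⟶ S.X₂, P.d j k ≫ h = g ≫ S.f :=
      ⟨hex.descToInjective (g ≫ S.f) hz, hex.comp_descToInjective (g ≫ S.f) hz⟩
    obtain ⟨u, hu⟩ := ih S.X₃ h3 j k (k + 1) hjk rfl (h ≫ S.g) (by
      rw [reassoc_of% hh, S.zero, comp_zero])
    have := hS.epi_g
    have := hS.mono_f
    have := hP (k + 1)
    have hz2 : (h - P.d k (k + 1) ≫ Projective.factorThru u S.g) ≫ S.g = 0 := by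
      simp [hu]
    refine ⟨hS.exact.lift _ hz2, ?_⟩
    have e : (P.d j k ≫ hS.exact.lift _ hz2) ≫ S.f = g ≫ S.f := by
      rw [Category.assoc, hS.exact.lift_f]
      simp [hh]
    exact (cancel_mono S.f).1 e

lemma injDim_of_resolution {M : C} (I : InjectiveResolution M) (n : ℕ)
    (hI : ∀ i : ℕ, n < i → IsZero (I.cocomplex.X i)) : HasInjectiveDimensionLT M (n + 1) := by
  let := HasExt.standard C
  rw [hasInjectiveDimensionLT_iff]
  intro i hi Y e
  obtain ⟨f, hf, rfl⟩ := I.extMk_surjective e (i + 1) rfl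
  obtain rfl : f = 0 := (hI i (by lia)).eq_of_tgt _ _
  simp

end

section

variable {R : Type u} [Ring R]

lemma finsupp_baer [IsNoetherianRing R] (σ : Type u) (M : Type u) [AddCommGroup M] [Module R M]
    (hM : Module.Baer R M) : Module.Baer R (σ →₀ M) := by
  classical
  intro I g
  obtain ⟨T, hT⟩ : ∃ T : Finset σ, ∀ r : I, (g r).support ⊆ T := by
    obtain ⟨G, hG⟩ := (Module.Finite.iff_fg.2 (IsNoetherian.noetherian I) : Module.Finite R I).fg_top
    refine ⟨G.biUnion fun r => (g r).support, fun r => ?_⟩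
    have hr : r ∈ Submodule.span R (G : Set I) := by rw [hG]; trivial
    induction hr using Submodule.span_induction with
    | mem x hx => exact Finset.subset_biUnion_of_mem (fun r => (g r).support) hx
    | zero => simp
    | add x y _ _ hx hy =>
      rw [map_add]
      exact Finsupp.support_add.trans (Finset.union_subset hx hy)
    | smul a x _ hx =>
      rw [map_smul]
      exact Finsupp.support_smul.trans hx
  have hc : ∀ t : σ, ∃ g' : R →ₗ[R] M, ∀ (x : R) (mem : x ∈ I), g' x = g ⟨x, mem⟩ t := by
    intro t
    exact hM I ((Finsupp.lapply t).comp g)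
  choose c hc using hc
  refine ⟨∑ t ∈ T, (Finsupp.lsingle t).comp (c t), fun x mem => ?_⟩
  ext t
  have h1 : (∑ t ∈ T, (Finsupp.lsingle t).comp (c t)) x = ∑ t ∈ T, Finsupp.single t (c t x) := by
    simp
  rw [h1, Finsupp.finsetSum_apply]
  simp only [Finsupp.single_apply, Finset.sum_ite_eq', hc _ x mem]
  split_ifs with h
  · rfl
  · by_contra h'
    exact h (hT ⟨x, mem⟩ (Finsupp.mem_support_iff.2 (Ne.symm h')))

lemma finsupp_injective [IsNoetherianRing R] (σ : Type u) (M : ModuleCat.{u} R)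
    [Injective M] : Injective (ModuleCat.of R (σ →₀ M)) := by
  have h : Module.Injective R M := Module.injective_module_of_injective_object R M
  have : Module.Injective R (σ →₀ M) :=
    (finsupp_baer σ M (Module.Baer.of_injective h)).injective
  exact Module.injective_object_of_injective_module R (σ →₀ M)

lemma finsupp_injDim [IsNoetherianRing R] (σ : Type u) (n : ℕ) : ∀ (M : ModuleCat.{u} R),
    HasInjectiveDimensionLT M (n + 1) →
    HasInjectiveDimensionLT (ModuleCat.of R (σ →₀ M)) (n + 1) := by
  induction n with
  | zero =>
    intro M hM
    have hM : HasInjectiveDimensionLT M 1 := hM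
    have : Injective M := injective_iff_hasInjectiveDimensionLT_one.2 hM
    have := finsupp_injective σ M
    change HasInjectiveDimensionLT _ 1
    infer_instance
  | succ n ih =>
    intro M hM
    let S : ShortComplex (ModuleCat.{u} R) :=
      ShortComplex.mk (Injective.ι M) (cokernel.π (Injective.ι M)) (by simp)
    have hS : S.ShortExact :=
      { exact := ShortComplex.exact_cokernel _
        mono_f := by dsimp [S]; infer_instance
        epi_g := by dsimp [S]; infer_instance }
    have hI : Injective S.X₂ := by dsimp [S]; infer_instance
    have h3 := ih _ ((hS.hasInjectiveDimensionLT_X₃_iff n hI).2 hM)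
    have hex := (ShortComplex.ShortExact.moduleCat_exact_iff_function_exact S).1 hS.exact
    have hin : Function.Injective S.f.hom := hS.moduleCat_injective_f
    have hsu : Function.Surjective S.g.hom := hS.moduleCat_surjective_g
    let S' : ShortComplex (ModuleCat.{u} R) :=
      ShortComplex.mk (X₁ := ModuleCat.of R (σ →₀ S.X₁)) (X₂ := ModuleCat.of R (σ →₀ S.X₂))
        (X₃ := ModuleCat.of R (σ →₀ S.X₃))
        (ModuleCat.ofHom (Finsupp.mapRange.linearMap S.f.hom))
        (ModuleCat.ofHom (Finsupp.mapRange.linearMap S.g.hom)) (by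
          apply ModuleCat.hom_ext
          apply LinearMap.ext
          intro x
          apply Finsupp.ext
          intro t
          exact hex.apply_apply_eq_zero (x t))
    have hS' : S'.ShortExact := by
      refine ShortComplex.ShortExact.mk' ?_ ?_ ?_
      · rw [ShortComplex.ShortExact.moduleCat_exact_iff_function_exact]
        intro y
        constructor
        · intro hy
          have hy' : ∀ t, ∃ a, S.f.hom a = y t := fun t =>
            (hex (y t)).1 (DFunLike.congr_fun hy t)
          choose a ha using hy'
          refine ⟨Finsupp.onFinset y.support a fun t ht => ?_, ?_⟩
          · rw [Finsupp.mem_support_iff]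
            intro h
            apply ht
            apply hin
            rw [ha, h, map_zero]
          · apply Finsupp.ext
            intro t
            exact ha t
        · rintro ⟨x, rfl⟩
          apply Finsupp.ext
          intro t
          exact hex.apply_apply_eq_zero (x t)
      · rw [ModuleCat.mono_iff_injective]
        exact Finsupp.mapRange_injective _ (map_zero _) hin
      · rw [ModuleCat.epi_iff_surjective]
        exact Finsupp.mapRange_surjective _ (map_zero _) hsu
    have := finsupp_injective σ S.X₂
    exact (hS'.hasInjectiveDimensionLT_X₃_iff n this).1 h3

lemma projective_injDim [IsNoetherianRing R] (n : ℕ)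
    (h : HasInjectiveDimensionLT (ModuleCat.of R R) (n + 1)) (Q : ModuleCat.{u} R)
    [hQ : Projective Q] : HasInjectiveDimensionLT Q (n + 1) := by
  have : Module.Projective R Q := (IsProjective.iff_projective Q).2 hQ
  obtain ⟨s, hs⟩ := (Module.projective_def' (R := R) (P := Q)).1 this
  have hr : Retract Q (ModuleCat.of R (Q →₀ R)) :=
    { i := ModuleCat.ofHom s
      r := ModuleCat.ofHom (Finsupp.linearCombination R id)
      retract := by
        rw [← ModuleCat.ofHom_comp, hs]
        rfl }
  have := finsupp_injDim Q n (ModuleCat.of R R) h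
  exact hr.hasInjectiveDimensionLT (n + 1)

end

end Stmt12Aux

/-- Let `R` be a Gorenstein ring (left and right Noetherian, of finite
injective dimension as a left and as a right module over itself). Let `P` be an acyclic
complex of projective left `R`-modules and `X` a complex which is either a bounded-below
complex of projectives or a bounded-above acyclic complex. Then `Ext¹_{Ch(R)}(P, X) = 0`. -/
theorem stmt12 {R : Type u} [Ring R]
    [IsNoetherianRing R] [IsNoetherianRing Rᵐᵒᵖ]
    (hGl : ∃ n : ℕ, HasInjDimLE (ModuleCat.of R R) n)
    (hGr : ∃ n : ℕ, HasInjDimLE (ModuleCat.of Rᵐᵒᵖ Rᵐᵒᵖ) n)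
    [HasExt.{w} (CochainComplex (ModuleCat.{u} R) ℤ)]
    (P X : CochainComplex (ModuleCat.{u} R) ℤ)
    (hPacyc : IsAcyclicComplex P) (hPproj : ∀ n : ℤ, Projective (P.X n))
    (hX : ((∃ N : ℤ, ∀ n : ℤ, n < N → IsZero (X.X n)) ∧ ∀ n : ℤ, Projective (X.X n)) ∨
          ((∃ N : ℤ, ∀ n : ℤ, N < n → IsZero (X.X n)) ∧ IsAcyclicComplex X)) :
    Subsingleton (Ext.{w} P X 1) := by
  have hEI : EnoughInjectives (CochainComplex (ModuleCat.{u} R) ℤ) := inferInstance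
  refine Stmt12Aux.subsingleton_ext_one P X hPproj fun φ hφ => ?_
  rcases hX with ⟨⟨N, hN⟩, hXp⟩ | ⟨⟨N, hN⟩, hXa⟩
  · obtain ⟨n, I, hI⟩ := hGl
    have hR := Stmt12Aux.injDim_of_resolution I n hI
    refine Stmt12Aux.homotopy_up P X φ hφ N hN fun i j k l hij hjk => ?_
    have := hXp l
    exact Stmt12Aux.ext_prop P hPproj hPacyc n (X.X l) (Stmt12Aux.projective_injDim n hR _)
      i j k hij hjk
  · refine Stmt12Aux.homotopy_down P X φ hφ N hN fun i j k l hij hjk g hg => ?_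
    have := hPproj l
    have hex : (X.sc' i j k).Exact :=
      (X.exactAt_iff' i j k (by simp; lia) (by simp; lia)).1 (hXa j)
    exact ⟨hex.liftFromProjective g hg, hex.liftFromProjective_comp g hg⟩
end

section
/- Let A be a Grothendieck abelian category and let (D, E) be a cotorsion pair in A cogenerated by a set, i.e. there is a set S of objects of A with S ⊆ D and E = {Y | Ext^1(S, Y) = 0 for all S ∈ S}. Then: (1) the pair has enough injectives, i.e. for every object Z there is a short exact sequence 0 → Z → Y → X → 0 with Y ∈ E and X ∈ D; and (2) the pair has enough projectives (for every object Z there is a short exact sequence 0 → Y → X → Z → 0 with X ∈ D and Y ∈ E) if and only if D is generating, i.e. every object of A is a quotient of a set-indexed coproduct of objects of D. -/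
open CategoryTheory CategoryTheory.Limits CategoryTheory.Abelian

universe w v u

variable {C : Type u} [Category.{v} C] [Abelian C]

/-- A class of objects is generating if every object is a quotient of a set-indexed
coproduct of objects of the class. -/
def IsGeneratingClass [HasColimits C] (D : Set C) : Prop :=
  ∀ X : C, ∃ (ι : Type v) (f : ι → C), (∀ i, f i ∈ D) ∧ ∃ p : (∐ f) ⟶ X, Epi p

section Helpers

open MorphismProperty

section ExtLemmas

variable [HasExt.{w} C]

lemma exists_lift_of_extClass {X : C} {S : ShortComplex C} (hS : S.ShortExact)
    (v : X ⟶ S.X₃) (h : (Ext.mk₀ v).comp hS.extClass (zero_add 1) = 0) :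
    ∃ v' : X ⟶ S.X₂, v' ≫ S.g = v := by
  obtain ⟨x, hx⟩ := Ext.covariant_sequence_exact₃ X hS (Ext.mk₀ v) (zero_add 1) h
  obtain ⟨v', rfl⟩ := (Ext.mk₀_bijective _ _).2 x
  refine ⟨v', (Ext.mk₀_bijective _ _).1 ?_⟩
  rw [← hx, Ext.mk₀_comp_mk₀]

lemma exists_extension {Y : C} {S : ShortComplex C} (hS : S.ShortExact)
    (h : Subsingleton (Ext.{w} S.X₃ Y 1)) (t : S.X₁ ⟶ Y) :
    ∃ t' : S.X₂ ⟶ Y, S.f ≫ t' = t := by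
  obtain ⟨x, hx⟩ := Ext.contravariant_sequence_exact₁ hS Y (Ext.mk₀ t) (add_zero 1)
    (Subsingleton.elim _ _)
  obtain ⟨v', rfl⟩ := (Ext.mk₀_bijective _ _).2 x
  refine ⟨v', (Ext.mk₀_bijective _ _).1 ?_⟩
  rw [← hx, Ext.mk₀_comp_mk₀]

/-- An extension problem with `Ext¹` vanishing has liftings. -/
lemma exists_square_lift {S T : ShortComplex C} (hS : S.ShortExact) (hT : T.ShortExact)
    (h : Subsingleton (Ext.{w} S.X₃ T.X₁ 1)) (a : S.X₁ ⟶ T.X₂) (b : S.X₂ ⟶ T.X₃)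
    (sq : a ≫ T.g = S.f ≫ b) :
    ∃ l : S.X₂ ⟶ T.X₂, S.f ≫ l = a ∧ l ≫ T.g = b := by
  have := hT.mono_f
  obtain ⟨l₀, hl₀⟩ : ∃ l₀ : S.X₂ ⟶ T.X₂, l₀ ≫ T.g = b := by
    apply exists_lift_of_extClass hT
    obtain ⟨y, hy⟩ := Ext.contravariant_sequence_exact₂ hS T.X₁
      ((Ext.mk₀ b).comp hT.extClass (zero_add 1)) (by
        rw [Ext.mk₀_comp_mk₀_assoc, ← sq, ← Ext.mk₀_comp_mk₀_assoc, hT.comp_extClass,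
          Ext.comp_zero])
    rw [← hy, Subsingleton.elim y 0, Ext.comp_zero]
  obtain ⟨t, ht⟩ := exists_extension hS h
    (hT.exact.lift (a - S.f ≫ l₀) (by simp [sq, hl₀]))
  refine ⟨l₀ + t ≫ T.f, ?_, by simp [hl₀]⟩
  rw [Preadditive.comp_add, ← Category.assoc, ht, hT.exact.lift_f]
  abel

lemma subsingleton_ext_of_lift {X : C} {S : ShortComplex C} (hS : S.ShortExact)
    [Injective S.X₂] (h : ∀ v : X ⟶ S.X₃, ∃ v' : X ⟶ S.X₂, v' ≫ S.g = v) :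
    Subsingleton (Ext.{w} X S.X₁ 1) := by
  refine subsingleton_of_forall_eq 0 fun x => ?_
  obtain ⟨y, rfl⟩ := Ext.covariant_sequence_exact₁ X hS x
    (Ext.eq_zero_of_injective _) (zero_add 1)
  obtain ⟨v, rfl⟩ := (Ext.mk₀_bijective _ _).2 y
  obtain ⟨v', rfl⟩ := h v
  rw [← Ext.mk₀_comp_mk₀_assoc, hS.comp_extClass, Ext.comp_zero]

lemma subsingleton_ext_middle {Y : C} {S : ShortComplex C} (hS : S.ShortExact)
    (h₁ : Subsingleton (Ext.{w} S.X₁ Y 1)) (h₃ : Subsingleton (Ext.{w} S.X₃ Y 1)) :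
    Subsingleton (Ext.{w} S.X₂ Y 1) := by
  refine subsingleton_of_forall_eq 0 fun x => ?_
  obtain ⟨y, rfl⟩ := Ext.contravariant_sequence_exact₂ hS Y x (Subsingleton.elim _ _)
  rw [Subsingleton.elim y 0, Ext.comp_zero]

end ExtLemmas

lemma exists_shortExact_injective [EnoughInjectives C] (Y : C) :
    ∃ (I Q : C) (i : Y ⟶ I) (p : I ⟶ Q) (z : i ≫ p = 0),
      (ShortComplex.mk i p z).ShortExact ∧ Injective I :=
  ⟨Injective.under Y, cokernel (Injective.ι Y), Injective.ι Y, cokernel.π _,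
    cokernel.condition _,
    { exact := ShortComplex.exact_cokernel _
      mono_f := inferInstanceAs (Mono (Injective.ι Y))
      epi_g := inferInstanceAs (Epi (cokernel.π _)) }, inferInstance⟩

lemma shortExact_of_isPushout {S : ShortComplex C} (hS : S.ShortExact) {Y P : C}
    {a : S.X₁ ⟶ Y} {inl : S.X₂ ⟶ P} {inr : Y ⟶ P} (sq : IsPushout S.f a inl inr) :
    ∃ g : P ⟶ S.X₃, IsShortExactSeq inr g := by
  have := hS.mono_f
  have := hS.epi_g
  have hz : S.f ≫ S.g = a ≫ 0 := by simp
  refine ⟨sq.desc S.g 0 hz, by simp, ?_⟩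
  have h1 : Mono inr := Abelian.mono_inr_of_isColimit _ _ sq.isColimit
  have h2 : Epi (sq.desc S.g 0 hz) := by
    have : Epi (inl ≫ sq.desc S.g 0 hz) := by
      rw [sq.inl_desc]; infer_instance
    exact epi_of_epi inl _
  refine { exact := ?_, mono_f := h1, epi_g := h2 }
  apply ShortComplex.exact_of_g_is_cokernel
  refine CokernelCofork.IsColimit.ofπ _ _ (fun {Z} k hk => hS.exact.desc (inl ≫ k) ?_) ?_ ?_
  · have hk' : inr ≫ k = 0 := hk
    rw [← Category.assoc, sq.w, Category.assoc, hk', comp_zero]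
  · intro Z k hk
    have hk' : inr ≫ k = 0 := hk
    apply sq.hom_ext
    · simp
    · simp [hk']
  · intro Z k hk m hm
    rw [← cancel_epi (sq.desc S.g 0 hz)]
    have hk' : inr ≫ k = 0 := hk
    have hm' : sq.desc S.g 0 hz ≫ m = k := hm
    rw [hm']
    apply sq.hom_ext
    · simp
    · simp [hk']

lemma hasSmallObjectArgument_ofHoms [IsGrothendieckAbelian.{v} C] {ι : Type v}
    {A B : ι → C} (f : ∀ i, A i ⟶ B i) [∀ i, Mono (f i)] :
    HasSmallObjectArgument.{v} (ofHoms f) := by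
  obtain ⟨κ, hκ', hκ⟩ :=
    HasCardinalLT.exists_regular_cardinal_forall.{v} (fun i => Subobject (A i))
  have : Fact κ.IsRegular := ⟨hκ'⟩
  have : Nonempty κ.ord.ToType := by simpa using hκ'.ne_zero
  have := WellFoundedLT.toOrderBot κ.ord.ToType
  exact ⟨κ, inferInstance, inferInstance,
    { preservesColimit {A' B' X Y} i hi g hg := by
        let hf' : (monomorphisms C).TransfiniteCompositionOfShape κ.ord.ToType g :=
          { toTransfiniteCompositionOfShape := hg.toTransfiniteCompositionOfShape
            map_mem j hj := by
              have := (hg.attachCells j hj).pushouts_coproducts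
              simp only [ofHoms_homFamily] at this
              refine (?_ : _ ≤ monomorphisms C) _ this
              simp only [pushouts_le_iff, coproducts_le_iff]
              rintro _ _ _ ⟨i⟩
              exact inferInstanceAs (Mono (f i)) }
        have (j j' : κ.ord.ToType) (φ : j ⟶ j') : Mono (hf'.F.map φ) := hf'.mem_map φ
        apply IsGrothendieckAbelian.preservesColimit_coyoneda_obj_of_mono (Y := hf'.F) (κ := κ)
        obtain ⟨i⟩ := hi
        exact hκ i }⟩

variable [HasColimits C]

/-- The canonical morphism from a coproduct of copies of `G`. -/
noncomputable abbrev sepMap (G s : C) (I : Set (G ⟶ s)) : (∐ fun _ : I => G) ⟶ s :=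
  Sigma.desc (fun h : I => h.1)

/-- Index type for the generating monomorphisms. -/
abbrev GenIdx (G : C) {κ : Type v} (F : κ → C) : Type v :=
  Σ k : κ, { I : Set (G ⟶ F k) // Epi (sepMap G (F k) I) }

/-- The generating monomorphisms. -/
noncomputable def genMap (G : C) {κ : Type v} (F : κ → C) (x : GenIdx G F) :
    kernel (sepMap G (F x.1) x.2.1) ⟶ ∐ fun _ : x.2.1 => G :=
  kernel.ι _

instance (G : C) {κ : Type v} (F : κ → C) (x : GenIdx G F) : Mono (genMap G F x) := by
  unfold genMap; infer_instance

lemma genMap_shortExact (G : C) {κ : Type v} (F : κ → C) (x : GenIdx G F) :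
    (ShortComplex.mk (genMap G F x) (sepMap G (F x.1) x.2.1)
      (kernel.condition _)).ShortExact :=
  { exact := ShortComplex.exact_kernel _
    mono_f := inferInstanceAs (Mono (genMap G F x))
    epi_g := x.2.2 }

lemma ext_zero_of_extends [HasExt.{w} C] [EnoughInjectives C] {G : C} (hG : IsSeparator G)
    {κ : Type v} (F : κ → C) (Y : C)
    (h : ∀ (x : GenIdx G F) (t : _ ⟶ Y), ∃ t', genMap G F x ≫ t' = t) (k : κ) :
    Subsingleton (Ext.{w} (F k) Y 1) := by
  obtain ⟨I, Q, i, p, z, hS, _⟩ := exists_shortExact_injective Y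
  have : Mono i := hS.mono_f
  have : Epi p := hS.epi_g
  have : Injective (ShortComplex.mk i p z).X₂ := by assumption
  refine subsingleton_ext_of_lift hS fun v => ?_
  change F k ⟶ Q at v
  change ∃ v' : F k ⟶ I, v' ≫ p = v
  let J : Set (G ⟶ F k) := {m | ∃ l : G ⟶ I, l ≫ p = m ≫ v}
  have hJ : Epi (sepMap G (F k) J) := by
    refine Preadditive.epi_of_cancel_zero _ fun {T} a ha => ?_
    rw [← cancel_epi (pullback.fst v p), comp_zero]
    refine (Preadditive.isSeparator_iff G).1 hG _ fun m => ?_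
    have hm : m ≫ pullback.fst v p ∈ J :=
      ⟨m ≫ pullback.snd v p, by rw [Category.assoc, Category.assoc, pullback.condition]⟩
    have := Sigma.ι (fun _ : J => G) ⟨_, hm⟩ ≫= ha
    simpa using this
  choose l hl using fun m : J => m.2
  let x : GenIdx G F := ⟨k, J, hJ⟩
  let L : (∐ fun _ : J => G) ⟶ I := Sigma.desc l
  have hL : L ≫ p = sepMap G (F k) J ≫ v := by
    apply Sigma.hom_ext
    intro b
    simp [L, hl]
  have hx := genMap_shortExact G F x
  have hgen : genMap G F x ≫ sepMap G (F k) J = 0 := kernel.condition _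
  obtain ⟨t', ht'⟩ := h x (hS.exact.lift (genMap G F x ≫ L) (by
    change (genMap G F x ≫ L) ≫ p = 0
    rw [Category.assoc, hL, reassoc_of% hgen, zero_comp]))
  have hlift := hS.exact.lift_f (genMap G F x ≫ L) (by
    change (genMap G F x ≫ L) ≫ p = 0
    rw [Category.assoc, hL, reassoc_of% hgen, zero_comp])
  have hk : genMap G F x ≫ (L - t' ≫ i) = 0 := by
    rw [Preadditive.comp_sub, ← Category.assoc _ t' i, ht', sub_eq_zero]
    exact hlift.symm
  have := hx.epi_g
  refine ⟨hx.exact.desc (L - t' ≫ i) hk, ?_⟩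
  have hd : sepMap G (F k) J ≫ hx.exact.desc (L - t' ≫ i) hk = L - t' ≫ i :=
    hx.exact.g_desc _ _
  rw [← cancel_epi (sepMap G (F k) J), reassoc_of% hd, Preadditive.sub_comp, hL,
    Category.assoc, z, comp_zero, sub_zero]

end Helpers

/-- Let `C` be a Grothendieck abelian category (abelian, cocomplete,
AB5, with a separator) and `(D, E)` a cotorsion pair cogenerated by a set `S ⊆ D`
(i.e. `E` is the `Ext¹`-orthogonal of `S`). Then (1) the pair has enough injectives, and
(2) it has enough projectives iff `D` is generating. -/
theorem stmt13 [HasColimits C] [AB5 C] [HasSeparator C] [HasExt.{w} C]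
    (D E : Set C) (hpair : IsCotorsionPair.{w} D E)
    (S : Set C) (hsmall : Small.{v} ↥S) (hSD : S ⊆ D)
    (hSE : E = {Y : C | ∀ s ∈ S, Subsingleton (Ext.{w} s Y 1)}) :
    (∀ Z : C, ∃ (Y X : C) (f : Z ⟶ Y) (g : Y ⟶ X),
        IsShortExactSeq f g ∧ Y ∈ E ∧ X ∈ D) ∧
    ((∀ Z : C, ∃ (X Y : C) (f : Y ⟶ X) (g : X ⟶ Z),
        IsShortExactSeq f g ∧ X ∈ D ∧ Y ∈ E) ↔ IsGeneratingClass D) := by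
  have : IsGrothendieckAbelian.{v} C := {}
  have hinj : EnoughInjectives C := IsGrothendieckAbelian.enoughInjectives.{v}
  have part1 : ∀ Z : C, ∃ (Y X : C) (f : Z ⟶ Y) (g : Y ⟶ X),
        IsShortExactSeq f g ∧ Y ∈ E ∧ X ∈ D := by
    intro Z
    obtain ⟨O, hO⟩ := HasZeroObject.zero (C := C)
    let G := separator C
    have hG : IsSeparator G := isSeparator_separator C
    let F : Shrink.{v} S → C := fun k => ((equivShrink S).symm k).1
    let J : MorphismProperty C := MorphismProperty.ofHoms (genMap G F)
    have : MorphismProperty.HasSmallObjectArgument.{v} J :=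
      hasSmallObjectArgument_ofHoms (genMap G F)
    let fac := (MorphismProperty.functorialFactorizationData J.rlp.llp
      J.rlp).factorizationData (0 : Z ⟶ O)
    have hmono : Mono fac.i := by
      have h0 : J.rlp (0 : Injective.under Z ⟶ O) := by
        rintro _ _ _ ⟨x⟩
        constructor
        intro a b sq
        exact ⟨⟨{ l := Injective.factorThru a (genMap G F x), fac_left := by simp,
                  fac_right := (hO).eq_of_tgt _ _ }⟩⟩
      have := fac.hi _ h0
      have sq : CommSq (Injective.ι Z) fac.i (0 : Injective.under Z ⟶ O) 0 := ⟨by simp⟩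
      have hm : Mono (fac.i ≫ sq.lift) := by rw [sq.fac_left]; infer_instance
      exact mono_of_mono _ sq.lift
    refine ⟨fac.Z, cokernel fac.i, fac.i, cokernel.π _, ⟨cokernel.condition _,
      { exact := ShortComplex.exact_cokernel _
        mono_f := hmono
        epi_g := inferInstanceAs (Epi (cokernel.π _)) }⟩, ?_, ?_⟩
    · rw [hSE]
      intro s hs
      have key := ext_zero_of_extends.{w} hG F fac.Z (fun x t => by
        have := fac.hp _ (⟨x⟩ : J (genMap G F x))
        have sq : CommSq t (genMap G F x) fac.p 0 :=
          ⟨(hO).eq_of_tgt _ _⟩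
        exact ⟨sq.lift, sq.fac_left⟩) (equivShrink S ⟨s, hs⟩)
      simpa [F] using key
    · rw [hpair.1]
      intro E' hE'
      obtain ⟨I, Q, i, p, z, hS, _⟩ := exists_shortExact_injective E'
      have : Injective (ShortComplex.mk i p z).X₂ := by assumption
      refine subsingleton_ext_of_lift hS fun v => ?_
      have hp : J.rlp p := by
        rintro _ _ _ ⟨x⟩
        constructor
        intro a b sq
        have hs : F x.1 ∈ S := ((equivShrink S).symm x.1).2
        rw [hSE] at hE'
        obtain ⟨l, hl₁, hl₂⟩ := exists_square_lift (genMap_shortExact G F x) hS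
          (hE' _ hs) a b sq.w
        exact ⟨⟨{ l := l, fac_left := hl₁, fac_right := hl₂ }⟩⟩
      have := fac.hi _ hp
      have sq : CommSq (0 : Z ⟶ I) fac.i p (cokernel.π fac.i ≫ v) := ⟨by simp⟩
      refine ⟨cokernel.desc fac.i sq.lift sq.fac_left, ?_⟩
      rw [← cancel_epi (cokernel.π fac.i), cokernel.π_desc_assoc]
      exact sq.fac_right
  refine ⟨part1, ?_, ?_⟩
  · intro h X
    obtain ⟨X', Y, f, g, ⟨z, hS⟩, hX, -⟩ := h X
    have : Epi g := hS.epi_g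
    refine ⟨PUnit, fun _ => X', fun _ => hX, Sigma.desc (fun _ => g), ?_⟩
    have : Epi (Sigma.ι (fun _ : PUnit.{v+1} => X') PUnit.unit ≫ Sigma.desc (fun _ => g)) := by
      rw [Sigma.ι_desc]; infer_instance
    exact epi_of_epi (Sigma.ι (fun _ : PUnit.{v+1} => X') PUnit.unit) _
  · intro h Z
    obtain ⟨ι, d, hd, q, hq⟩ := h Z
    have hD : (∐ d) ∈ D := by
      rw [hpair.1]
      intro E' hE'
      obtain ⟨I, Q, i, p, z, hS, _⟩ := exists_shortExact_injective E'
      have : Injective (ShortComplex.mk i p z).X₂ := by assumption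
      refine subsingleton_ext_of_lift hS fun v => ?_
      have hl : ∀ j, ∃ l : d j ⟶ I, l ≫ p = Sigma.ι d j ≫ v := fun j => by
        have := (hpair.1 (d j)).1 (hd j) E' hE'
        exact exists_lift_of_extClass hS (Sigma.ι d j ≫ v) (Subsingleton.elim (α := Ext.{w} (d j) E' 1) _ _)
      choose l hl using hl
      refine ⟨Sigma.desc l, ?_⟩
      apply Sigma.hom_ext
      intro j
      simp [hl]
    have hT : (ShortComplex.mk (kernel.ι q) q (kernel.condition q)).ShortExact :=
      { exact := ShortComplex.exact_kernel _
        mono_f := inferInstanceAs (Mono (kernel.ι q))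
        epi_g := hq }
    obtain ⟨Y, X, f, g, ⟨z, hS⟩, hY, hX⟩ := part1 (kernel q)
    have sq := IsPushout.of_hasPushout (kernel.ι q) f
    obtain ⟨g₁, hg₁⟩ := shortExact_of_isPushout hT sq
    obtain ⟨g₂, z₂, hg₂⟩ := shortExact_of_isPushout hS sq.flip
    refine ⟨_, Y, _, g₁, hg₁, ?_, hY⟩
    rw [hpair.1]
    intro E' hE'
    exact subsingleton_ext_middle hg₂ ((hpair.1 _).1 hD E' hE') ((hpair.1 _).1 hX E' hE')
end

section
/- Let A be a Grothendieck abelian category with enough projectives. Then every cotorsion pair (D, E) in A cogenerated by a set (i.e. such that there is a set S ⊆ D of objects with E = {Y | Ext^1(S, Y) = 0 for all S ∈ S}) is complete: for every object Z there is a short exact sequence 0 → Y → X → Z → 0 with X ∈ D and Y ∈ E, and a short exact sequence 0 → Z → Y → X → 0 with Y ∈ E and X ∈ D. -/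
open CategoryTheory CategoryTheory.Limits CategoryTheory.Abelian

universe w v u

variable {C : Type u} [Category.{v} C] [Abelian C]

section Helpers

/-- Maps out of the kernel of a projective presentation extend, if `Ext¹` vanishes. -/
lemma ext_iff_extend [HasExt.{w} C] {T : ShortComplex C} (hT : T.ShortExact)
    [Projective T.X₂] (Y : C) :
    Subsingleton (Ext.{w} T.X₃ Y 1) ↔ ∀ f : T.X₁ ⟶ Y, ∃ f' : T.X₂ ⟶ Y, T.f ≫ f' = f := by
  constructor
  · intro h f
    obtain ⟨x₂, hx₂⟩ := Ext.contravariant_sequence_exact₁ hT Y (Ext.mk₀ f) (add_zero 1)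
      (Subsingleton.elim _ _)
    obtain ⟨f', rfl⟩ := (Ext.mk₀_bijective _ _).2 x₂
    refine ⟨f', (Ext.mk₀_bijective _ _).1 ?_⟩
    rw [← hx₂, Ext.mk₀_comp_mk₀]
  · intro h
    refine subsingleton_of_forall_eq 0 (fun x ↦ ?_)
    obtain ⟨x₁, rfl⟩ := Ext.contravariant_sequence_exact₃ hT Y x
      (Ext.eq_zero_of_projective _) (add_zero 1)
    obtain ⟨f, rfl⟩ := (Ext.mk₀_bijective _ _).2 x₁
    obtain ⟨f', rfl⟩ := h f
    rw [← Ext.mk₀_comp_mk₀]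
    exact hT.extClass_comp_assoc _

/-- If maps `X ⟶ T.X₃` lift to the injective `T.X₂`, then `Ext¹(X, T.X₁)` vanishes. -/
lemma ext_of_lift [HasExt.{w} C] {T : ShortComplex C} (hT : T.ShortExact)
    [Injective T.X₂] (X : C) (h : ∀ f : X ⟶ T.X₃, ∃ f' : X ⟶ T.X₂, f' ≫ T.g = f) :
    Subsingleton (Ext.{w} X T.X₁ 1) := by
  refine subsingleton_of_forall_eq 0 (fun x ↦ ?_)
  obtain ⟨x₁, rfl⟩ := Ext.covariant_sequence_exact₁ X hT x
    (Ext.eq_zero_of_injective _) (zero_add 1)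
  obtain ⟨f, rfl⟩ := (Ext.mk₀_bijective _ _).2 x₁
  obtain ⟨f', rfl⟩ := h f
  rw [← Ext.mk₀_comp_mk₀, Ext.comp_assoc_of_second_deg_zero, hT.comp_extClass, Ext.comp_zero]

/-- Small families of monomorphisms in a Grothendieck category permit the small
object argument. -/
lemma hasSmallObjectArgument_of_mono [IsGrothendieckAbelian.{v} C] [HasColimits C] {ι : Type u}
    [Small.{v} ι] (A B : ι → C) (i : ∀ k, A k ⟶ B k) [∀ k, Mono (i k)] :
    MorphismProperty.HasSmallObjectArgument.{v} (MorphismProperty.ofHoms i) := by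
  have hI : MorphismProperty.ofHoms i ≤ MorphismProperty.monomorphisms C := by
    rintro _ _ _ ⟨k⟩
    exact inferInstanceAs (Mono _)
  obtain ⟨κ, hκ', hκ⟩ := HasCardinalLT.exists_regular_cardinal_forall.{v}
    (fun k ↦ Subobject (A k))
  have : Fact κ.IsRegular := ⟨hκ'⟩
  have : Nonempty κ.ord.ToType := by simpa using hκ'.ne_zero
  have := WellFoundedLT.toOrderBot κ.ord.ToType
  exact ⟨κ, inferInstance, inferInstance,
    { preservesColimit {A B X Y} i hi f hf := by
        let hf' : (MorphismProperty.monomorphisms C).TransfiniteCompositionOfShape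
            κ.ord.ToType f :=
          { toTransfiniteCompositionOfShape := hf.toTransfiniteCompositionOfShape
            map_mem j hj := by
              have := (hf.attachCells j hj).pushouts_coproducts
              simp only [MorphismProperty.ofHoms_homFamily] at this
              refine (?_ : _ ≤ MorphismProperty.monomorphisms C) _ this
              simp only [MorphismProperty.pushouts_le_iff, MorphismProperty.coproducts_le_iff]
              exact hI }
        have (j j' : κ.ord.ToType) (φ : j ⟶ j') : Mono (hf'.F.map φ) := hf'.mem_map φ
        apply IsGrothendieckAbelian.preservesColimit_coyoneda_obj_of_mono (Y := hf'.F) (κ := κ)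
        obtain ⟨k⟩ := hi
        exact hκ k }⟩

end Helpers

/-- Let `C` be a Grothendieck abelian category (abelian, cocomplete,
AB5, with a separator) with enough projectives. Then every cotorsion pair `(D, E)`
cogenerated by a set `S ⊆ D` is complete: it has enough projectives and enough
injectives. -/
theorem stmt14 [HasColimits C] [AB5 C] [HasSeparator C] [EnoughProjectives C]
    [HasExt.{w} C]
    (D E : Set C) (hpair : IsCotorsionPair.{w} D E)
    (S : Set C) (hsmall : Small.{v} ↥S) (hSD : S ⊆ D)
    (hSE : E = {Y : C | ∀ s ∈ S, Subsingleton (Ext.{w} s Y 1)}) :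
    (∀ Z : C, ∃ (X Y : C) (f : Y ⟶ X) (g : X ⟶ Z),
        IsShortExactSeq f g ∧ X ∈ D ∧ Y ∈ E) ∧
    (∀ Z : C, ∃ (Y X : C) (f : Z ⟶ Y) (g : Y ⟶ X),
        IsShortExactSeq f g ∧ Y ∈ E ∧ X ∈ D) := by
  have hG : IsGrothendieckAbelian.{v} C := { }
  -- projective presentations of the objects of `S`
  let T : S → ShortComplex C := fun s ↦
    ShortComplex.mk (kernel.ι (Projective.π s.1)) (Projective.π s.1) (kernel.condition _)
  have hT : ∀ s, (T s).ShortExact := fun s ↦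
    { exact := ShortComplex.exact_of_f_is_kernel _ (kernelIsKernel _)
      mono_f := by dsimp [T]; infer_instance
      epi_g := by dsimp [T]; infer_instance }
  have hTP : ∀ s, Projective (T s).X₂ := fun s ↦ by dsimp [T]; infer_instance
  have hTm : ∀ s, Mono (T s).f := fun s ↦ (hT s).mono_f
  have hE : ∀ Y, Y ∈ E ↔ ∀ (s : S) (f : (T s).X₁ ⟶ Y), ∃ f', (T s).f ≫ f' = f := by
    intro Y
    rw [hSE]
    constructor
    · intro h s
      exact (ext_iff_extend (hT s) Y).1 (h s.1 s.2)
    · intro h s hs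
      exact (ext_iff_extend (hT ⟨s, hs⟩) Y).2 (h ⟨s, hs⟩)
  let I : MorphismProperty C := MorphismProperty.ofHoms (fun s : S ↦ (T s).f)
  have hI : I ≤ MorphismProperty.monomorphisms C := by
    rintro _ _ _ ⟨s⟩
    exact hTm s
  have : MorphismProperty.HasSmallObjectArgument.{v} I := hasSmallObjectArgument_of_mono _ _ _
  -- the kernel of a map in `I.rlp` is in `E`
  have hker : ∀ {A B K : C} (i : K ⟶ A) (p : A ⟶ B) (w : i ≫ p = 0)
      (_ : IsLimit (KernelFork.ofι i w)), I.rlp p → K ∈ E := by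
    intro A B K i p w hl hp
    rw [hE]
    intro s f
    have := hp (T s).f ⟨s⟩
    have sq : CommSq (f ≫ i) (T s).f p 0 := ⟨by simp [w]⟩
    obtain ⟨l, hl'⟩ := KernelFork.IsLimit.lift' hl sq.lift (by simp)
    refine ⟨l, ?_⟩
    have : Mono i := mono_of_isLimit_fork hl
    rw [← cancel_mono i, Category.assoc]
    erw [hl']
    simp
  -- epimorphisms with kernel in `E` are in `I.rlp`
  have hrlp : ∀ {U : ShortComplex C} (_ : U.ShortExact), U.X₁ ∈ E → I.rlp U.g := by
    rintro U hU hUE _ _ _ ⟨s⟩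
    refine ⟨fun {a b} sq ↦ ?_⟩
    have := hU.epi_g
    have := hU.mono_f
    let c : (T s).X₂ ⟶ U.X₂ := Projective.factorThru b U.g
    have hc : c ≫ U.g = b := Projective.factorThru_comp _ _
    have hd : (a - (T s).f ≫ c) ≫ U.g = 0 := by
      rw [Preadditive.sub_comp, Category.assoc, hc, sq.w, sub_self]
    obtain ⟨e, he⟩ := (hE _).1 hUE s (hU.exact.lift _ hd)
    refine ⟨⟨⟨c + e ≫ U.f, ?_, ?_⟩⟩⟩
    · rw [Preadditive.comp_add, ← Category.assoc, he, hU.exact.lift_f]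
      abel
    · simp [Preadditive.add_comp, hc]
  -- lifting criterion for `D`
  have hD : ∀ X : C, (∀ {U : ShortComplex C} (_ : U.ShortExact), U.X₁ ∈ E →
      ∀ f : X ⟶ U.X₃, ∃ f' : X ⟶ U.X₂, f' ≫ U.g = f) → X ∈ D := by
    intro X h
    rw [hpair.1]
    intro Y hY
    let U : ShortComplex C :=
      ShortComplex.mk (Injective.ι Y) (cokernel.π (Injective.ι Y)) (cokernel.condition _)
    have hU : U.ShortExact :=
      { exact := ShortComplex.exact_of_g_is_cokernel _ (cokernelIsCokernel _)
        mono_f := by dsimp [U]; infer_instance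
        epi_g := by dsimp [U]; infer_instance }
    have : Injective U.X₂ := by dsimp [U]; infer_instance
    exact ext_of_lift hU X (h hU hY)
  constructor
  · intro Z
    let F := MorphismProperty.factorizationData I.rlp.llp I.rlp (Projective.π Z)
    have : Epi F.p := by
      have : Epi (F.i ≫ F.p) := by rw [F.fac]; infer_instance
      exact epi_of_epi F.i F.p
    refine ⟨F.Z, kernel F.p, kernel.ι _, F.p, ⟨kernel.condition _,
      { exact := ShortComplex.exact_of_f_is_kernel _ (kernelIsKernel _)
        mono_f := by dsimp; infer_instance
        epi_g := by dsimp; infer_instance }⟩, hD _ ?_,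
      hker (kernel.ι F.p) F.p (kernel.condition _) (kernelIsKernel _) F.hp⟩
    intro U hU hUE f
    have := hU.epi_g
    have := F.hi U.g (hrlp hU hUE)
    have sq : CommSq (Projective.factorThru (F.i ≫ f) U.g) F.i U.g f := ⟨by simp⟩
    exact ⟨sq.lift, by simp⟩
  · intro Z
    open scoped ZeroObject in
    let F := MorphismProperty.factorizationData I.rlp.llp I.rlp (0 : Z ⟶ 0)
    have : Mono F.i := by
      have h := MorphismProperty.antitone_llp (MorphismProperty.antitone_rlp hI) _ F.hi
      rwa [IsGrothendieckAbelian.llp_rlp_monomorphisms (isSeparator_separator C)] at h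
    refine ⟨F.Z, cokernel F.i, F.i, cokernel.π _, ⟨cokernel.condition _,
      { exact := ShortComplex.exact_of_g_is_cokernel _ (cokernelIsCokernel _)
        mono_f := by dsimp; infer_instance
        epi_g := by dsimp; infer_instance }⟩, ?_, hD _ ?_⟩
    · rw [hE]
      intro s f
      have := F.hp (T s).f ⟨s⟩
      have sq : CommSq f (T s).f F.p 0 := ⟨(isZero_zero C).eq_of_tgt _ _⟩
      exact ⟨sq.lift, by simp⟩
    · intro U hU hUE f
      have := F.hi U.g (hrlp hU hUE)
      have sq : CommSq 0 F.i U.g (cokernel.π F.i ≫ f) := ⟨by simp⟩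
      refine ⟨cokernel.desc _ sq.lift (by simp), ?_⟩
      rw [← cancel_epi (cokernel.π F.i)]
      simp
end

section
/- Let A and B be Grothendieck abelian categories and F : A → B a functor preserving all small colimits. Then there exist arbitrarily large regular cardinals κ such that F sends κ-presentable objects of A to κ-presentable objects of B; that is, for every cardinal λ there is a regular cardinal κ ≥ λ such that for every κ-presentable object X of A, the object F(X) is κ-presentable in B. -/
open CategoryTheory CategoryTheory.Limits Opposite

universe v u₁ u₂

/-- A category `J` is `κ`-filtered if every diagram in `J` indexed by a category with
fewer than `κ` morphisms admits a cocone. -/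
def IsCardinalFilteredCat (J : Type v) [SmallCategory J] (κ : Cardinal.{v}) : Prop :=
  ∀ (K : Type v) [SmallCategory K], Cardinal.mk (Arrow K) < κ →
    ∀ G : K ⥤ J, Nonempty (Cocone G)

/-- An object `X` is `κ`-presentable if `Hom(X, −)` preserves colimits of every
`κ`-filtered shape. -/
def IsCardinalPresentableObj {C : Type u₁} [Category.{v} C] (X : C)
    (κ : Cardinal.{v}) : Prop :=
  ∀ (J : Type v) [SmallCategory J], IsCardinalFilteredCat J κ →
    PreservesColimitsOfShape J (coyoneda.obj (op X))

namespace Stmt18Aux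

section

variable {C : Type u₁} [Category.{v} C] [Abelian C] [HasColimits C] [IsGrothendieckAbelian.{v} C]

open IsGrothendieckAbelian IsPresentable in
/-- Surjectivity part of presentability: `G` is a separator and the cardinal is larger than the
number of subobjects of `X` and of a suitable coproduct of copies of `G`. -/
lemma surj {X G : C} (hG : IsSeparator G) {κ : Cardinal.{v}} [Fact κ.IsRegular]
    (hX : HasCardinalLT (Subobject X) κ)
    (hQ : HasCardinalLT (Subobject (∐ (fun _ : Shrink.{v} (Subobject X) => G))) κ)
    {J : Type v} [SmallCategory J] [IsCardinalFiltered J κ] {Y : J ⥤ C} {c : Cocone Y}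
    (hc : IsColimit c) (z : X ⟶ c.pt) :
    ∃ (j : J) (y : X ⟶ Y.obj j), z = y ≫ c.ι.app j := by
  have := isFiltered_of_isCardinalFiltered J κ
  have hiso := surjectivity.isIso_f hc z
  let T := Shrink.{v} (Subobject X)
  have hT : HasCardinalLT T κ := by
    rwa [← hasCardinalLT_iff_of_equiv (equivShrink.{v} (Subobject X))]
  -- the choice of lifts
  have key : ∀ t : T, ∃ (j : J) (y : G ⟶ Y.obj j) (q : G ⟶ X), y ≫ c.ι.app j = q ≫ z ∧
      ∀ (j' : J) (y' : G ⟶ Y.obj j') (q' : G ⟶ X), y' ≫ c.ι.app j' = q' ≫ z →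
        equivShrink _ (imageSubobject q') = t → imageSubobject q = imageSubobject q' := by
    intro t
    by_cases h : ∃ (j' : J) (y' : G ⟶ Y.obj j') (q' : G ⟶ X), y' ≫ c.ι.app j' = q' ≫ z ∧
        equivShrink _ (imageSubobject q') = t
    · obtain ⟨j, y, q, h1, h2⟩ := h
      exact ⟨j, y, q, h1, fun j' y' q' h1' h2' =>
        (equivShrink _).injective (h2.trans h2'.symm)⟩
    · exact ⟨IsFiltered.nonempty.some, 0, 0, by simp, fun j' y' q' h1' h2' =>
        (h ⟨j', y', q', h1', h2'⟩).elim⟩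
  choose j y q hyq huniv using key
  let m : J := IsCardinalFiltered.max j hT
  let Q : C := ∐ (fun _ : T => G)
  let p : Q ⟶ X := Sigma.desc q
  let w : Q ⟶ Y.obj m := Sigma.desc (fun t => y t ≫ Y.map (IsCardinalFiltered.toMax j hT t))
  have hw : w ≫ c.ι.app m = p ≫ z := by
    apply Sigma.hom_ext
    intro t
    simp [w, p, hyq]
  have hp : Epi p := by
    apply Preadditive.epi_of_cancel_zero
    intro Z h hph
    have hq : ∀ t, q t ≫ h = 0 := fun t => by
      have := Sigma.ι (fun _ : T => G) t ≫= hph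
      simpa [p] using this
    rw [← cancel_epi (surjectivity.f z), comp_zero]
    apply colimit.hom_ext
    intro j'
    rw [comp_zero, ← Category.assoc, surjectivity.hf]
    apply hG.def
    intro g
    rw [comp_zero, ← Category.assoc]
    have hcomm : (g ≫ (pullback.fst c.ι ((Functor.const J).map z)).app j') ≫ c.ι.app j' =
        (g ≫ (pullback.snd c.ι ((Functor.const J).map z)).app j') ≫ z := by
      have := NatTrans.congr_app (pullback.condition (f := c.ι) (g := (Functor.const J).map z)) j'
      simp only [NatTrans.comp_app, Functor.const_map_app] at this
      simp only [Category.assoc]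
      exact congrArg (fun a => g ≫ a) this
    have himg := huniv _ _ _ _ hcomm rfl
    generalize (g ≫ (pullback.snd c.ι ((Functor.const J).map z)).app j' : G ⟶ X) = q' at himg ⊢
    generalize equivShrink _ (imageSubobject q') = t at himg
    have h0 : (imageSubobject (q t)).arrow ≫ h = 0 := by
      rw [← cancel_epi (factorThruImageSubobject (q t)), comp_zero, ← Category.assoc,
        imageSubobject_arrow_comp, hq]
    rw [himg] at h0
    rw [← imageSubobject_arrow_comp q', Category.assoc, h0, comp_zero]
  have hK : HasCardinalLT (Subobject (kernel p)) κ :=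
    hQ.of_injective _ (Subobject.map_obj_injective (kernel.ι p))
  obtain ⟨l, φ, hφ⟩ := injectivity₀ hc hK (kernel.ι p ≫ w) (by
    rw [Category.assoc, hw, kernel.condition_assoc, zero_comp])
  rw [Category.assoc] at hφ
  let x : X ⟶ Y.obj l := (Abelian.epiIsCokernelOfKernel _ (kernelIsKernel p)).desc
    (CokernelCofork.ofπ (w ≫ Y.map φ) hφ)
  have hx : p ≫ x = w ≫ Y.map φ :=
    (Abelian.epiIsCokernelOfKernel _ (kernelIsKernel p)).fac
      (CokernelCofork.ofπ (w ≫ Y.map φ) hφ) WalkingParallelPair.one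
  refine ⟨l, x, ?_⟩
  rw [← cancel_epi p, ← Category.assoc, hx, Category.assoc, c.w, hw]

open IsGrothendieckAbelian IsPresentable in
lemma isPresentable (X : C) : IsPresentable.{v} X := by
  obtain ⟨G, hG⟩ := HasSeparator.hasSeparator (C := C)
  obtain ⟨κ, hκ, h⟩ := HasCardinalLT.exists_regular_cardinal.{v}
    (Subobject X ⊕ Subobject (∐ (fun _ : Shrink.{v} (Subobject X) => G)))
  have : Fact κ.IsRegular := ⟨hκ⟩
  have hX := h.of_injective _ Sum.inl_injective
  have hQ := h.of_injective _ Sum.inr_injective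
  have : IsCardinalPresentable X κ := ⟨fun J _ _ => ⟨fun {Y} => ⟨fun {c} hc => ⟨by
    have := isFiltered_of_isCardinalFiltered J κ
    exact Types.FilteredColimit.isColimitOf' _ _
      (surj hG hX hQ hc) (injectivity hc hX)⟩⟩⟩⟩
  exact isPresentable_of_isCardinalPresentable X κ

lemma iff_presentable {X : C} {κ : Cardinal.{v}} [Fact κ.IsRegular] :
    IsCardinalPresentableObj X κ ↔ IsCardinalPresentable X κ := by
  constructor
  · intro h
    refine ⟨fun J _ hJ => h J fun K _ hK G => ?_⟩
    exact hJ.nonempty_cocone G ((hasCardinalLT_iff_cardinal_mk_lt _ _).2 hK)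
  · intro h J _ hJ
    have : IsCardinalFiltered J κ :=
      ⟨fun {K} _ G hK => hJ K ((hasCardinalLT_iff_cardinal_mk_lt _ _).1 hK) G⟩
    exact preservesColimitsOfShape_of_isCardinalPresentable X κ J

end

end Stmt18Aux

/-- Let `A`, `B` be Grothendieck abelian categories (abelian, cocomplete,
AB5, with a separator) and `F : A ⥤ B` a functor preserving all small colimits. Then
there exist arbitrarily large regular cardinals `κ` such that `F` sends `κ`-presentable
objects to `κ`-presentable objects. -/
theorem stmt18 {A : Type u₁} {B : Type u₂} [Category.{v} A] [Category.{v} B]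
    [Abelian A] [HasColimits A] [AB5 A] [HasSeparator A]
    [Abelian B] [HasColimits B] [AB5 B] [HasSeparator B]
    (F : A ⥤ B) [PreservesColimits F] :
    ∀ lam : Cardinal.{v}, ∃ κ : Cardinal.{v}, lam ≤ κ ∧ κ.IsRegular ∧
      ∀ X : A, IsCardinalPresentableObj X κ → IsCardinalPresentableObj (F.obj X) κ := by
  intro lam
  have : IsGrothendieckAbelian.{v} A := {}
  have : IsGrothendieckAbelian.{v} B := {}
  obtain ⟨G, hG⟩ := HasSeparator.hasSeparator (C := A)
  obtain ⟨κ₁, hκ₁, h₁⟩ := (Stmt18Aux.isPresentable G).exists_cardinal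
  obtain ⟨κ₂, hκ₂, h₂⟩ := (Stmt18Aux.isPresentable (F.obj G)).exists_cardinal
  let κ : Cardinal.{v} := Order.succ (max (max lam (max κ₁ κ₂)) Cardinal.aleph0)
  have hκ : κ.IsRegular := Cardinal.isRegular_succ (le_max_right _ _)
  have hle : max lam (max κ₁ κ₂) ≤ κ := (le_max_left _ _).trans (Order.le_succ _)
  have l0 : lam ≤ κ := (le_max_left _ _).trans hle
  have l1 : κ₁ ≤ κ := ((le_max_left _ _).trans (le_max_right _ _)).trans hle
  have l2 : κ₂ ≤ κ := ((le_max_right _ _).trans (le_max_right _ _)).trans hle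
  have : Fact κ.IsRegular := ⟨hκ⟩
  refine ⟨κ, l0, hκ, fun X hX => ?_⟩
  rw [Stmt18Aux.iff_presentable] at hX ⊢
  have g1 : IsCardinalPresentable G κ := isCardinalPresentable_of_le G l1
  have g2 : IsCardinalPresentable (F.obj G) κ := isCardinalPresentable_of_le (F.obj G) l2
  have hS : (ObjectProperty.singleton G).IsStrongGenerator := by
    rw [ObjectProperty.isStrongGenerator_iff]
    refine ⟨hG, fun Y Z i _ hi => ?_⟩
    have : Epi i := by
      apply Preadditive.epi_of_cancel_zero
      intro W h hh
      apply hG.def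
      intro g
      obtain ⟨f, rfl⟩ := hi G (by simp) g
      simp [hh]
    exact isIso_of_mono_of_epi i
  have hS2 : ObjectProperty.singleton G ≤ isCardinalPresentable A κ := by
    rintro _ ⟨⟩
    exact g1
  have heq := IsStrongGenerator.colimitsCardinalClosure_eq_isCardinalPresentable hS hS2
  have hX' : isCardinalPresentable A κ X := hX
  rw [heq] at hX'
  have hle2 : (ObjectProperty.singleton G).colimitsCardinalClosure κ ≤
      (isCardinalPresentable B κ).inverseImage F := by
    apply ObjectProperty.colimitsCardinalClosure_le
    · intro J _ hJ
      have := isClosedUnderColimitsOfShape_isCardinalPresentable B hJ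
      infer_instance
    · rintro _ ⟨⟩
      exact g2
  exact hle2 _ hX'
end
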